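/- arXiv:1712.03947 — 2 statements merged into one kernel-verified Lean document; each statement's English description precedes it below -/
import Mathlib

section
/- Assume 2^(p−1) ≢ 1 (mod p²). Then for every integer h with 0 ≤ h < p^n that is not divisible by p^(n−1), and for every k with 0 ≤ k < d_n, the value T_k^(p^n)(α_n^h) is neither 0 nor 1, i.e., it does not lie in the prime subfield F₂ of ᾱ. -/
/-- The generalized cyclotomic class `D_i^(p^j)` of order `d_j = p^(j-1)·(p-1)/e`
with respect to a primitive root `g`:
`D_i^(p^j) = { g^(d_j·t + i) mod p^j : 0 ≤ t < e }`. -/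
def Dclass (p e g j i : ℕ) : Set (ZMod (p ^ j)) :=
  {x | ∃ t < e, x = (g : ZMod (p ^ j)) ^ (p ^ (j - 1) * ((p - 1) / e) * t + i)}

/-- `E_l^(p^j)(x) = Σ_{i ∈ D_l^(p^j)} x^i`, exponents being the integer
representatives `g^(d_j·t + l) mod p^j ∈ [0, p^j)` of the elements of `D_l^(p^j)`. -/
noncomputable def Epoly (p e g j l : ℕ) (x : AlgebraicClosure (ZMod 2)) :
    AlgebraicClosure (ZMod 2) :=
  ∑ t ∈ Finset.range e, x ^ (g ^ (p ^ (j - 1) * ((p - 1) / e) * t + l) % p ^ j)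

/-- `H_k^(p^j)(x) = Σ_{i=0}^{d_j/2-1} E_((i+k) mod d_j)^(p^j)(x)`. -/
noncomputable def Hpoly (p e g j k : ℕ) (x : AlgebraicClosure (ZMod 2)) :
    AlgebraicClosure (ZMod 2) :=
  ∑ i ∈ Finset.range (p ^ (j - 1) * ((p - 1) / e) / 2),
    Epoly p e g j ((i + k) % (p ^ (j - 1) * ((p - 1) / e))) x

/-- `T_k^(p^j)(x) = H_k^(p^j)(x) + H_k^(p^(j-1))(x^p) + ⋯ + H_k^(p)(x^(p^(j-1)))`. -/
noncomputable def Tpoly (p e g j k : ℕ) (x : AlgebraicClosure (ZMod 2)) :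
    AlgebraicClosure (ZMod 2) :=
  ∑ l ∈ Finset.range j, Hpoly p e g (j - l) k (x ^ p ^ l)

lemma aux_gen (p : ℕ) (hp : p.Prime) (hodd : Odd p)
    (hw : ¬ (2 ^ (p - 1) ≡ 1 [MOD p ^ 2])) (m : ℕ) (b : ℕ) (hb : b ≡ 1 [MOD p]) :
    ∃ s, 2 ^ s ≡ b [MOD p ^ (m + 1)] := by
  classical
  have hp2 : p ≠ 2 := by rintro rfl; exact absurd hodd (by decide)
  have : Fact p.Prime := ⟨hp⟩
  have h2p : Nat.Coprime 2 p := (Nat.coprime_primes Nat.prime_two hp).2 (Ne.symm hp2)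
  have hfer : 2 ^ (p - 1) ≡ 1 [MOD p] := by
    have := Nat.ModEq.pow_totient h2p
    rwa [Nat.totient_prime hp] at this
  obtain ⟨a, ha⟩ := (Nat.modEq_iff_dvd' (Nat.one_le_two_pow)).1 hfer.symm
  have ha' : 2 ^ (p - 1) = 1 + p * a := by
    have : 1 ≤ 2 ^ (p - 1) := Nat.one_le_two_pow
    omega
  have hpa : ¬ (p : ℤ) ∣ (a : ℤ) := by
    intro hd
    have hd' : p ∣ a := by exact_mod_cast hd
    apply hw
    rw [ha']
    obtain ⟨c, rfl⟩ := hd'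
    have : p ^ 2 ∣ p * (p * c) := ⟨c, by ring⟩
    simpa using (Nat.modEq_zero_iff_dvd.2 this).add_left 1
  have hord := ZMod.orderOf_one_add_mul_prime hp hp2 a hpa m
  have hc2 : Nat.Coprime 2 (p ^ (m + 1)) := h2p.pow_right _
  have hcb : Nat.Coprime b (p ^ (m + 1)) := by
    apply Nat.Coprime.pow_right
    have := hb.gcd_eq
    simpa [Nat.Coprime] using this
  let u : (ZMod (p ^ (m + 1)))ˣ := ZMod.unitOfCoprime 2 hc2 ^ (p - 1)
  let v : (ZMod (p ^ (m + 1)))ˣ := ZMod.unitOfCoprime b hcb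
  have hu : orderOf u = p ^ m := by
    rw [← orderOf_units]
    have : (u : ZMod (p ^ (m + 1))) = 1 + p * (a : ℤ) := by
      have : ((2 ^ (p - 1) : ℕ) : ZMod (p ^ (m + 1))) = ((1 + p * a : ℕ) : ZMod (p ^ (m + 1))) := by
        rw [ha']
      simpa [u] using this
    rw [this, hord]
  have hv : v ^ p ^ m = 1 := by
    have h1 : (p : ℤ) ∣ (b : ℤ) - 1 := by
      have := (Nat.modEq_iff_dvd.1 hb.symm)
      simpa using this
    have h2 := dvd_sub_pow_of_dvd_sub h1 m
    ext
    have h3 : (((b : ℤ) ^ p ^ m - 1 ^ p ^ m : ℤ) : ZMod (p ^ (m + 1))) = 0 := by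
      rw [ZMod.intCast_zmod_eq_zero_iff_dvd]
      exact_mod_cast h2
    have h4 := sub_eq_zero.1 (by simpa using h3)
    simpa [v] using h4
  have := ZMod.isCyclic_units_of_prime_pow p hp hp2 (m + 1)
  have hle := IsCyclic.card_pow_eq_one_le (α := (ZMod (p ^ (m + 1)))ˣ) (n := p ^ m)
    (pow_pos hp.pos m)
  have heq : (Finset.range (p ^ m)).image (fun i => u ^ i) =
      Finset.univ.filter (fun x : (ZMod (p ^ (m + 1)))ˣ => x ^ p ^ m = 1) := by
    apply Finset.eq_of_subset_of_card_le
    · intro x hx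
      obtain ⟨i, -, rfl⟩ := Finset.mem_image.1 hx
      simp only [Finset.mem_filter, Finset.mem_univ, true_and]
      rw [← pow_mul, mul_comm, pow_mul, ← hu, pow_orderOf_eq_one, one_pow]
    · rw [Finset.card_image_of_injOn]
      · simpa using hle
      · intro i hi j hj hij
        apply pow_injOn_Iio_orderOf _ _ hij
        · simpa [hu] using hi
        · simpa [hu] using hj
  have hmem : v ∈ (Finset.range (p ^ m)).image (fun i => u ^ i) := by
    rw [heq]; simpa using hv
  obtain ⟨i, -, hi⟩ := Finset.mem_image.1 hmem
  refine ⟨(p - 1) * i, ?_⟩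
  rw [← ZMod.natCast_eq_natCast_iff]
  have := congrArg (Units.val) hi
  simpa [u, v, pow_mul] using this

lemma aux_geom {K : Type*} [Field K] (p : ℕ) (hp : p.Prime) (ω : K) (hω : IsPrimitiveRoot ω p)
    (w : ℕ) : ∑ i ∈ Finset.range p, (ω ^ w) ^ i = if p ∣ w then (p : K) else 0 := by
  split_ifs with hd
  · rw [(hω.pow_eq_one_iff_dvd w).2 hd]; simp
  · exact (hω.pow_of_coprime w ((hp.coprime_iff_not_dvd.2 hd).symm)).geom_sum_eq_zero hp.one_lt

lemma aux_pow_modEq {M : Type*} [Monoid M] {x : M} {N a b : ℕ} (hx : x ^ N = 1)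
    (h : a ≡ b [MOD N]) : x ^ a = x ^ b := by
  rw [← Nat.mod_add_div a N, ← Nat.mod_add_div b N, pow_add, pow_add, pow_mul, pow_mul, hx, h]
  simp

lemma aux_frob_sum {K ι : Type*} [Field K] [CharP K 2] (s : Finset ι) (f : ι → K) (t : ℕ) :
    (∑ i ∈ s, f i) ^ 2 ^ t = ∑ i ∈ s, f i ^ 2 ^ t := by
  have : Fact (Nat.Prime 2) := ⟨Nat.prime_two⟩
  have : ExpChar K 2 := ExpChar.prime Nat.prime_two
  exact sum_pow_char_pow 2 t s f

/-- Isolation of the residue class of `c` modulo `p`. -/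
lemma aux_isolate {K ι : Type*} [Field K] [CharP K 2] (p : ℕ) (hp : p.Prime) (hodd : Odd p)
    (hw : ¬ (2 ^ (p - 1) ≡ 1 [MOD p ^ 2])) (m : ℕ) (x : K)
    (hx : IsPrimitiveRoot x (p ^ (m + 2))) (I : Finset ι) (u : ι → ℕ)
    (H : K) (hH : H = ∑ a ∈ I, x ^ u a)
    (hfix : ∀ s, 2 ^ s ≡ 1 [MOD p ^ (m + 1)] → H ^ 2 ^ s = H) (c : ℕ) (hc : ¬ p ∣ c) :
    ∑ a ∈ I.filter (fun a => u a ≡ c [MOD p]), x ^ u a = 0 := by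
  set ω := x ^ p ^ (m + 1) with hωdef
  have hω : IsPrimitiveRoot ω p := by
    apply hx.pow (pow_pos hp.pos _)
    ring
  have key : ∀ i : ℕ, H = ∑ a ∈ I, x ^ u a * ω ^ (i * u a) := by
    intro i
    obtain ⟨s, hs⟩ := aux_gen p hp hodd hw (m + 1) (1 + i * p ^ (m + 1)) (by
      have : p ∣ i * p ^ (m + 1) := ⟨i * p ^ m, by ring⟩
      simpa using (Nat.modEq_zero_iff_dvd.2 this).add_left 1)
    have hs1 : 2 ^ s ≡ 1 [MOD p ^ (m + 1)] := by
      refine (hs.of_dvd (pow_dvd_pow _ (by omega))).trans ?_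
      have : p ^ (m + 1) ∣ i * p ^ (m + 1) := ⟨i, by ring⟩
      simpa using (Nat.modEq_zero_iff_dvd.2 this).add_left 1
    rw [← hfix s hs1, hH, aux_frob_sum]
    refine Finset.sum_congr rfl fun a _ => ?_
    rw [← pow_mul, hωdef, ← pow_mul, ← pow_add]
    apply aux_pow_modEq hx.pow_eq_one
    refine (hs.mul_left (u a)).trans ?_
    rw [show u a * (1 + i * p ^ (m + 1)) = u a + p ^ (m + 1) * (i * u a) by ring]
  have hsum : ∑ i ∈ Finset.range p, (ω ^ ((p - 1) * c)) ^ i * H = 0 := by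
    rw [← Finset.sum_mul, aux_geom p hp ω hω, if_neg, zero_mul]
    rw [hp.dvd_mul]
    rintro (h | h)
    · exact absurd (Nat.le_of_dvd (by have := hp.two_le; omega) h) (by have := hp.two_le; omega)
    · exact hc h
  have h2 : ∑ i ∈ Finset.range p, (ω ^ ((p - 1) * c)) ^ i * H =
      ∑ a ∈ I, x ^ u a * (if p ∣ u a + (p - 1) * c then (p : K) else 0) := by
    have : ∀ i ∈ Finset.range p, (ω ^ ((p - 1) * c)) ^ i * H =
        ∑ a ∈ I, x ^ u a * (ω ^ (u a + (p - 1) * c)) ^ i := by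
      intro i _
      rw [key i, Finset.mul_sum]
      refine Finset.sum_congr rfl fun a _ => ?_
      clear_value ω
      rw [mul_comm i (u a), pow_add, mul_pow, pow_mul ω (u a) i]
      ring
    rw [Finset.sum_congr rfl this, Finset.sum_comm]
    refine Finset.sum_congr rfl fun a _ => ?_
    rw [← Finset.mul_sum, aux_geom p hp ω hω]
  have hiff : ∀ a, p ∣ u a + (p - 1) * c ↔ u a ≡ c [MOD p] := by
    intro a
    have h0 : c + (p - 1) * c ≡ 0 [MOD p] := by
      apply Nat.modEq_zero_iff_dvd.2
      refine ⟨c, ?_⟩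
      obtain ⟨q, rfl⟩ : ∃ q, p = q + 1 := ⟨p - 1, by have := hp.two_le; omega⟩
      simp; ring
    rw [← Nat.modEq_zero_iff_dvd]
    constructor
    · intro h
      exact Nat.ModEq.add_right_cancel' _ (h.trans h0.symm)
    · intro h
      exact (h.add_right _).trans h0
  have hpK : (p : K) = 1 := by
    obtain ⟨q, rfl⟩ := hodd
    have : (2 : K) = 0 := CharTwo.two_eq_zero
    push_cast
    simp [this]
  rw [Finset.sum_filter]
  rw [hsum] at h2
  refine Eq.trans ?_ h2.symm
  refine Finset.sum_congr rfl fun a _ => ?_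
  simp [hiff, hpK]

/-- A geometric-exponent sum cannot vanish. -/
lemma aux_telescope {K : Type*} [Field K] [CharP K 2] (p : ℕ) (hp : p.Prime) (hodd : Odd p)
    (hw : ¬ (2 ^ (p - 1) ≡ 1 [MOD p ^ 2])) (m : ℕ) (y : K)
    (hy : IsPrimitiveRoot y (p ^ (m + 2))) (γ N : ℕ) (hγ : γ ≡ 1 [MOD p]) (hN : ¬ p ∣ N)
    (hS : ∑ j ∈ Finset.range N, y ^ γ ^ j = 0) : γ ≡ 1 [MOD p ^ 2] := by
  obtain ⟨s, hs⟩ := aux_gen p hp hodd hw (m + 1) γ hγ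
  have h1 : ∑ j ∈ Finset.range N, y ^ γ ^ (j + 1) = 0 := by
    have : (∑ j ∈ Finset.range N, y ^ γ ^ j) ^ 2 ^ s = 0 := by
      rw [hS]; exact zero_pow (by positivity)
    rw [aux_frob_sum] at this
    rw [← this]
    refine Finset.sum_congr rfl fun j _ => ?_
    rw [← pow_mul]
    apply aux_pow_modEq hy.pow_eq_one
    rw [pow_succ]
    exact (hs.symm).mul_left _
  have h2 := Finset.sum_range_sub (fun j => y ^ γ ^ j) N
  rw [Finset.sum_sub_distrib, h1, hS, sub_zero, pow_zero, pow_one] at h2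
  have h3 : y ^ γ ^ N = y ^ 1 := by rw [pow_one]; exact sub_eq_zero.1 h2.symm
  have h4 : γ ^ N ≡ 1 [MOD p ^ (m + 2)] := by
    rw [hy.eq_orderOf]
    exact (hy.isOfFinOrder (pow_ne_zero _ hp.ne_zero)).pow_eq_pow_iff_modEq.1 h3
  have h5 : γ ^ N ≡ 1 [MOD p ^ 2] := h4.of_dvd (pow_dvd_pow _ (by omega))
  have h6 : γ ^ p ≡ 1 [MOD p ^ 2] := by
    have hh : (p : ℤ) ∣ (γ : ℤ) - 1 := by
      simpa using (Nat.modEq_iff_dvd.1 hγ.symm)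
    have := dvd_sub_pow_of_dvd_sub hh 1
    apply Nat.ModEq.symm
    rw [Nat.modEq_iff_dvd]
    simpa using this
  rw [← ZMod.natCast_eq_natCast_iff] at h5 h6 ⊢
  push_cast at h5 h6 ⊢
  have h7 := Nat.dvd_gcd (orderOf_dvd_of_pow_eq_one h5) (orderOf_dvd_of_pow_eq_one h6)
  rw [((hp.coprime_iff_not_dvd.2 hN).symm : Nat.gcd N p = 1)] at h7
  exact orderOf_eq_one_iff.1 (Nat.dvd_one.1 h7)

lemma aux_comb {K : Type*} [Field K] (p e F M N g n k : ℕ) (hp : p.Prime) (hodd : Odd p)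
    (he : 0 < e) (hF : 0 < F) (hFe : Even F) (hpe : p - 1 = e * F)
    (hM : M = 1 + p ^ n * (e - 1)) (hN : N = (p ^ n + 1) / 2)
    (hgp : ∀ a b, g ^ a ≡ g ^ b [MOD p] ↔ a ≡ b [MOD (p - 1)])
    (hgn : (g ^ (p ^ n * F * e)) ≡ 1 [MOD p ^ (n + 1)])
    (x : K) (hx : x ^ p ^ (n + 1) = 1) :
    ∑ a ∈ (Finset.range (p ^ n * F / 2) ×ˢ Finset.range e).filter
        (fun a => g ^ (p ^ n * F * a.2 + (a.1 + k) % (p ^ n * F)) ≡ g ^ k [MOD p]),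
      x ^ g ^ (p ^ n * F * a.2 + (a.1 + k) % (p ^ n * F)) =
    ∑ j ∈ Finset.range N, x ^ g ^ (k + F * M * j) := by
  set d := p ^ n * F with hd
  have hdpos : 0 < d := Nat.mul_pos (pow_pos hp.pos n) hF
  have hpne : p ^ n ≡ 1 [MOD e] := by
    have h1 : p ≡ 1 [MOD e] := by
      have : e ∣ p - 1 := ⟨F, hpe⟩
      exact ((Nat.modEq_iff_dvd' hp.one_lt.le).2 this).symm
    simpa using h1.pow n
  have heM : e ∣ M := by
    rw [← Nat.modEq_zero_iff_dvd, hM]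
    have h1 : 1 + p ^ n * (e - 1) ≡ 1 + 1 * (e - 1) [MOD e] := (hpne.mul_right _).add_left 1
    refine h1.trans ?_
    rw [Nat.modEq_zero_iff_dvd]
    exact ⟨1, by omega⟩
  have hpd : p - 1 ∣ d * e := by rw [hpe, hd]; exact ⟨p ^ n, by ring⟩
  have hFd : F ∣ d := ⟨p ^ n, by rw [hd]; ring⟩
  have hFp : F ∣ p - 1 := ⟨e, by rw [hpe]; ring⟩
  -- `k + F M j ≡ F j + k` modulo `d`
  have hAd : ∀ j, (k + F * M * j) % d = (F * j + k) % d := by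
    intro j
    have : k + F * M * j = (F * j + k) + d * ((e - 1) * j) := by rw [hM, hd]; ring
    rw [this, Nat.add_mul_mod_self_left]
  have hexp : ∀ j, d * (((k + F * M * j) / d) % e) + (F * j + k) % d =
      (k + F * M * j) % (d * e) := by
    intro j
    rw [Nat.mod_mul (x := k + F * M * j) (a := d) (b := e), hAd, add_comm]
  have hAk : ∀ j, (k + F * M * j) % (d * e) ≡ k [MOD (p - 1)] := by
    intro j
    refine ((Nat.mod_modEq _ _).of_dvd hpd).trans ?_
    have : p - 1 ∣ F * M * j := by
      obtain ⟨c, hc⟩ := heM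
      rw [hpe, hc]; exact ⟨c * j, by ring⟩
    have h0 := (Nat.modEq_zero_iff_dvd.2 this).add_left k
    rwa [add_zero] at h0
  have hpn : p ^ n % 2 = 1 := Nat.odd_iff.1 (hodd.pow)
  have hjN : ∀ j, F * j < d / 2 ↔ j < N := by
    intro j
    obtain ⟨F', rfl⟩ := hFe
    have hF' : 0 < F' := by omega
    have h1 : d / 2 = F' * p ^ n := by
      rw [hd, show p ^ n * (F' + F') = 2 * (F' * p ^ n) by ring]
      exact Nat.mul_div_cancel_left _ two_pos
    rw [h1, show (F' + F') * j = F' * (2 * j) by ring, Nat.mul_lt_mul_left hF', hN]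
    omega
  symm
  refine Finset.sum_bij (fun j _ => (F * j, ((k + F * M * j) / d) % e)) ?_ ?_ ?_ ?_
  · intro j hj
    simp only [Finset.mem_filter, Finset.mem_product, Finset.mem_range] at hj ⊢
    refine ⟨⟨(hjN j).2 hj, Nat.mod_lt _ he⟩, ?_⟩
    rw [hexp, hgp]
    exact hAk j
  · intro i _ j _ hij
    have := congrArg Prod.fst hij
    exact Nat.eq_of_mul_eq_mul_left hF this
  · rintro ⟨i, t⟩ hit
    simp only [Finset.mem_filter, Finset.mem_product, Finset.mem_range] at hit
    obtain ⟨⟨hi, ht⟩, hg'⟩ := hit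
    rw [hgp] at hg'
    have hFi : F ∣ i := by
      have h1 := hg'.of_dvd hFp
      have h2 : d * t + (i + k) % d ≡ 0 + (i + k) [MOD F] :=
        Nat.ModEq.add (Nat.modEq_zero_iff_dvd.2 (hFd.mul_right t))
          ((Nat.mod_modEq _ _).of_dvd hFd)
      have h3 : i + k ≡ 0 + k [MOD F] := by
        have := h2.symm.trans h1
        simpa using this
      exact Nat.modEq_zero_iff_dvd.1 (Nat.ModEq.add_right_cancel' k h3)
    obtain ⟨j, rfl⟩ := hFi
    refine ⟨j, Finset.mem_range.2 ((hjN j).1 hi), ?_⟩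
    rw [Prod.mk.injEq]
    refine ⟨rfl, ?_⟩
    have h4 : d * (((k + F * M * j) / d) % e) + (F * j + k) % d ≡
        d * t + (F * j + k) % d [MOD (p - 1)] := by
      rw [hexp]; exact (hAk j).trans hg'.symm
    have h5 := Nat.ModEq.add_right_cancel' _ h4
    rw [hpe, hd, show ∀ z, p ^ n * F * z = (p ^ n * z) * F by intro z; ring,
      show ∀ z, p ^ n * F * z = (p ^ n * z) * F by intro z; ring] at h5
    have h6 := Nat.ModEq.mul_right_cancel' hF.ne' h5
    have h7 : ∀ z, p ^ n * z ≡ z [MOD e] := fun z => by simpa using hpne.mul_right z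
    have h8 := (h7 _).symm.trans (h6.trans (h7 _))
    exact Nat.ModEq.eq_of_lt_of_lt h8 (Nat.mod_lt _ he) ht
  · intro j _
    simp only
    rw [hexp]
    apply aux_pow_modEq hx
    conv_lhs => rw [← Nat.mod_add_div (k + F * M * j) (d * e)]
    rw [pow_add g, pow_mul g (d * e)]
    have := (hgn.pow ((k + F * M * j) / (d * e))).mul_left (g ^ ((k + F * M * j) % (d * e)))
    simpa using this

lemma aux_order (p g : ℕ) (hp : p.Prime) 
    (hg : orderOf (g : ZMod (p ^ 2)) = Nat.totient (p ^ 2)) :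
    Nat.Coprime g p ∧ (∀ a b, g ^ a ≡ g ^ b [MOD p] ↔ a ≡ b [MOD (p - 1)]) ∧
    (∀ c, g ^ c ≡ 1 [MOD p ^ 2] → p * (p - 1) ∣ c) := by
  have htot : Nat.totient (p ^ 2) = p * (p - 1) := by
    rw [Nat.totient_prime_pow hp two_pos]; simp
  have hpos : 0 < p * (p - 1) := Nat.mul_pos hp.pos (by have := hp.two_le; omega)
  have h2 : ∀ c, g ^ c ≡ 1 [MOD p ^ 2] → p * (p - 1) ∣ c := by
    intro c hc
    rw [← ZMod.natCast_eq_natCast_iff] at hc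
    rw [← htot, ← hg]
    apply orderOf_dvd_of_pow_eq_one
    simpa using hc
  have hcop : Nat.Coprime g p := by
    have h1 : (g : ZMod (p ^ 2)) ^ (p * (p - 1)) = 1 := by
      rw [← htot, ← hg]; exact pow_orderOf_eq_one _
    have hu : IsUnit (g : ZMod (p ^ 2)) := IsUnit.of_pow_eq_one h1 hpos.ne'
    rw [ZMod.isUnit_iff_coprime] at hu
    exact Nat.Coprime.coprime_dvd_right ⟨p, by ring⟩ hu
  have hone : ∀ c, g ^ c ≡ 1 [MOD p] → p - 1 ∣ c := by
    intro c hc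
    have hh : (p : ℤ) ∣ ((g : ℤ) ^ c) - 1 := by
      simpa using (Nat.modEq_iff_dvd.1 hc.symm)
    have := dvd_sub_pow_of_dvd_sub hh 1
    have h3 : g ^ (p * c) ≡ 1 [MOD p ^ 2] := by
      apply Nat.ModEq.symm
      rw [Nat.modEq_iff_dvd]
      rw [mul_comm p c]
      simpa [pow_mul] using this
    exact Nat.dvd_of_mul_dvd_mul_left hp.pos (h2 _ h3)
  have hfer : g ^ (p - 1) ≡ 1 [MOD p] := by
    have := Nat.ModEq.pow_totient hcop
    rwa [Nat.totient_prime hp] at this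
  have hle : ∀ a b, a ≤ b → (g ^ a ≡ g ^ b [MOD p] ↔ a ≡ b [MOD (p - 1)]) := by
    intro a b hab
    obtain ⟨c, rfl⟩ := Nat.exists_eq_add_of_le hab
    constructor
    · intro h
      rw [pow_add] at h
      have h' : g ^ a * 1 ≡ g ^ a * g ^ c [MOD p] := by simpa using h
      have h1 : 1 ≡ g ^ c [MOD p] :=
        Nat.ModEq.cancel_left_of_coprime (hcop.symm.pow_right a) h'
      have := (Nat.modEq_zero_iff_dvd.2 (hone c h1.symm)).add_left a
      simpa using this.symm
    · intro h
      have h1 : 0 ≡ c [MOD (p - 1)] := Nat.ModEq.add_left_cancel' a (by simpa using h)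
      obtain ⟨q, rfl⟩ := Nat.modEq_zero_iff_dvd.1 h1.symm
      rw [pow_add, pow_mul]
      have := ((hfer.pow q).mul_left (g ^ a)).symm
      simpa using this
  refine ⟨hcop, fun a b => ?_, h2⟩
  rcases le_total a b with h | h
  · exact hle a b h
  · exact ⟨fun h' => ((hle b a h).1 h'.symm).symm, fun h' => ((hle b a h).2 h'.symm).symm⟩

lemma aux_Hpoly_frob (p e g j k s : ℕ) (y : AlgebraicClosure (ZMod 2)) (hy : y ^ 2 ^ s = y) :
    Hpoly p e g j k y ^ 2 ^ s = Hpoly p e g j k y := by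
  have : CharP (AlgebraicClosure (ZMod 2)) 2 := charP_of_injective_algebraMap
    (algebraMap (ZMod 2) (AlgebraicClosure (ZMod 2))).injective 2
  unfold Hpoly Epoly
  rw [aux_frob_sum]
  refine Finset.sum_congr rfl fun i _ => ?_
  rw [aux_frob_sum]
  refine Finset.sum_congr rfl fun t _ => ?_
  rw [pow_right_comm, hy]

lemma aux_main (p : ℕ) (hp : p.Prime) (hodd : Odd p)
    (hw : ¬ (2 ^ (p - 1) ≡ 1 [MOD p ^ 2]))
    (e F : ℕ) (he : 0 < e) (hpe : p - 1 = e * F) (hF : 0 < F) (hFe : Even F)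
    (hfd : (p - 1) / e = F)
    (g : ℕ) (hg : orderOf (g : ZMod (p ^ 2)) = Nat.totient (p ^ 2))
    (n m k : ℕ) (hmn : m ≤ n) (x : AlgebraicClosure (ZMod 2))
    (hx : IsPrimitiveRoot x (p ^ (m + 2)))
    (hT : Tpoly p e g (n + 2) k x ^ 2 = Tpoly p e g (n + 2) k x) : False := by
  have : CharP (AlgebraicClosure (ZMod 2)) 2 := charP_of_injective_algebraMap
    (algebraMap (ZMod 2) (AlgebraicClosure (ZMod 2))).injective 2
  obtain ⟨hcop, hgp, hg2⟩ := aux_order p g hp hg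
  have hxn : x ^ p ^ (n + 1 + 1) = 1 :=
    (hx.pow_eq_one_iff_dvd _).2 (pow_dvd_pow _ (by omega))
  have hTs : ∀ s, Tpoly p e g (n + 2) k x ^ 2 ^ s = Tpoly p e g (n + 2) k x := by
    intro s
    induction s with
    | zero => simp
    | succ s ih => rw [pow_succ, pow_mul, ih, hT]
  have hsplit : Tpoly p e g (n + 2) k x =
      ∑ l ∈ Finset.range (n + 1), Hpoly p e g (n + 2 - (l + 1)) k (x ^ p ^ (l + 1)) +
        Hpoly p e g (n + 2) k x := by
    unfold Tpoly
    rw [Finset.sum_range_succ']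
    simp
  have : ExpChar (AlgebraicClosure (ZMod 2)) 2 := ExpChar.prime Nat.prime_two
  have hfix : ∀ s, 2 ^ s ≡ 1 [MOD p ^ (m + 1)] →
      Hpoly p e g (n + 2) k x ^ 2 ^ s = Hpoly p e g (n + 2) k x := by
    intro s hs
    have h1 := hTs s
    rw [hsplit, add_pow_char_pow, aux_frob_sum] at h1
    have h2 : ∀ l ∈ Finset.range (n + 1),
        Hpoly p e g (n + 2 - (l + 1)) k (x ^ p ^ (l + 1)) ^ 2 ^ s =
        Hpoly p e g (n + 2 - (l + 1)) k (x ^ p ^ (l + 1)) := by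
      intro l _
      apply aux_Hpoly_frob
      rw [← pow_mul]
      apply aux_pow_modEq hx.pow_eq_one
      have h3 := (hs.mul_left' (p ^ (l + 1)))
      rw [mul_one] at h3
      exact h3.of_dvd ⟨p ^ l, by ring⟩
    rw [Finset.sum_congr rfl h2] at h1
    exact add_left_cancel h1
  have hH : Hpoly p e g (n + 2) k x =
      ∑ a ∈ Finset.range (p ^ (n + 1) * F / 2) ×ˢ Finset.range e,
        x ^ g ^ (p ^ (n + 1) * F * a.2 + (a.1 + k) % (p ^ (n + 1) * F)) := by
    unfold Hpoly Epoly
    rw [Finset.sum_product, hfd]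
    refine Finset.sum_congr rfl fun i _ => Finset.sum_congr rfl fun t _ => ?_
    exact aux_pow_modEq hxn (Nat.mod_modEq _ _)
  have hpgk : ¬ p ∣ g ^ k := (hp.coprime_iff_not_dvd).1 ((hcop.pow_left k).symm)
  have h0 := aux_isolate p hp hodd hw m x hx _ _ _ hH hfix (g ^ k) hpgk
  have hgn : (g ^ (p ^ (n + 1) * F * e)) ≡ 1 [MOD p ^ (n + 1 + 1)] := by
    have := Nat.ModEq.pow_totient (hcop.pow_right (n + 1 + 1))
    rw [Nat.totient_prime_pow hp (by omega), hpe] at this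
    rwa [show p ^ (n + 1) * F * e = p ^ (n + 1 + 1 - 1) * (e * F) by simp; ring]
  rw [aux_comb p e F _ _ g (n + 1) k hp hodd he hF hFe hpe rfl rfl hgp hgn x hxn] at h0
  set M := 1 + p ^ (n + 1) * (e - 1) with hM
  set N := (p ^ (n + 1) + 1) / 2 with hN
  have hy : IsPrimitiveRoot (x ^ g ^ k) (p ^ (m + 2)) :=
    hx.pow_of_coprime _ ((hcop.pow_left k).pow_right _)
  have hFp : ¬ p ∣ F := by
    intro h
    have h1 := Nat.le_of_dvd hF h
    have h2 : F ≤ p - 1 := by rw [hpe]; exact Nat.le_mul_of_pos_left F he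
    have := hp.two_le
    omega
  have hpM : ¬ p ∣ M := by
    intro h
    have h1 : p ∣ p ^ (n + 1) * (e - 1) := ⟨p ^ n * (e - 1), by ring⟩
    exact hp.one_lt.ne' (Nat.dvd_one.1 ((Nat.dvd_add_left h1).1 h))
  have hpN : ¬ p ∣ N := by
    intro h
    have h1 : p ∣ p ^ (n + 1) := ⟨p ^ n, by ring⟩
    have hpn : p ^ (n + 1) % 2 = 1 := Nat.odd_iff.1 (hodd.pow)
    have h2 : p ^ (n + 1) + 1 = 2 * N := by omega
    have h3 : p ∣ p ^ (n + 1) + 1 := by rw [h2]; exact h.mul_left 2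
    exact hp.one_lt.ne' (Nat.dvd_one.1 ((Nat.dvd_add_right h1).1 h3))
  have heM : e ∣ M := by
    have h1 : p ≡ 1 [MOD e] :=
      ((Nat.modEq_iff_dvd' hp.one_lt.le).2 ⟨F, hpe⟩).symm
    have hpne : p ^ (n + 1) ≡ 1 [MOD e] := by simpa using h1.pow (n + 1)
    rw [← Nat.modEq_zero_iff_dvd, hM]
    refine ((hpne.mul_right _).add_left 1).trans ?_
    rw [Nat.modEq_zero_iff_dvd]
    exact ⟨1, by omega⟩
  have hγ : g ^ (F * M) ≡ 1 [MOD p] := by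
    rw [← pow_zero g, hgp, Nat.modEq_zero_iff_dvd, hpe, mul_comm e F]
    exact mul_dvd_mul_left F heM
  have hS : ∑ j ∈ Finset.range N, (x ^ g ^ k) ^ (g ^ (F * M)) ^ j = 0 := by
    rw [← h0]
    refine Finset.sum_congr rfl fun j _ => ?_
    rw [← pow_mul, ← pow_mul, ← pow_add]
  have h1 := aux_telescope p hp hodd hw m _ hy _ N hγ hpN hS
  have h2 := (Dvd.intro _ rfl).trans (hg2 _ h1)
  rcases hp.dvd_mul.1 h2 with h | h
  · exact hFp h
  · exact hpM h

/-- assume `2^(p-1) ≢ 1 (mod p²)`. Then for every `h < p^n` not divisible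
by `p^(n-1)` and every `k < d_n`, the value `T_k^(p^n)(α_n^h)` is neither `0` nor `1`,
i.e. it does not lie in the prime subfield `F₂` of `ᾱ`. -/
theorem Tpoly_not_in_prime_field
    (p : ℕ) (hp : p.Prime) (hodd : Odd p)
    (hw : ¬ (2 ^ (p - 1) ≡ 1 [MOD p ^ 2]))
    (e r : ℕ) (he : 0 < e) (hef : e ∣ p - 1) (hr : 1 ≤ r) (hf : (p - 1) / e = 2 ^ r)
    (g : ℕ) (hg : orderOf (g : ZMod (p ^ 2)) = Nat.totient (p ^ 2))
    (n : ℕ) (hn : 1 ≤ n)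
    (α : AlgebraicClosure (ZMod 2)) (hα : IsPrimitiveRoot α (p ^ n))
    (h : ℕ) (hh : h < p ^ n) (hhp : ¬ (p ^ (n - 1) ∣ h))
    (k : ℕ) (hk : k < p ^ (n - 1) * ((p - 1) / e)) :
    Tpoly p e g n k (α ^ h) ≠ 0 ∧ Tpoly p e g n k (α ^ h) ≠ 1 := by
  have he' : p - 1 = e * 2 ^ r := by rw [← hf, Nat.mul_div_cancel' hef]
  have hα0 : (α ^ h) ^ p ^ n = 1 := by rw [pow_right_comm, hα.pow_eq_one, one_pow]
  obtain ⟨m, hmn, hm⟩ := (Nat.dvd_prime_pow hp).1 (orderOf_dvd_of_pow_eq_one hα0)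
  have hm2 : 2 ≤ m := by
    by_contra hlt
    apply hhp
    have h1 : (α ^ h) ^ p = 1 := by
      apply orderOf_dvd_iff_pow_eq_one.1
      rw [hm]
      simpa using pow_dvd_pow p (show m ≤ 1 by omega)
    rw [← pow_mul, hα.pow_eq_one_iff_dvd] at h1
    obtain ⟨q, rfl⟩ : ∃ q, n = q + 1 := ⟨n - 1, by omega⟩
    rw [pow_succ] at h1
    exact Nat.dvd_of_mul_dvd_mul_right hp.pos h1
  obtain ⟨m, rfl⟩ : ∃ q, m = q + 2 := ⟨m - 2, by omega⟩
  obtain ⟨n, rfl⟩ : ∃ q, n = q + 2 := ⟨n - 2, by omega⟩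
  have hx : IsPrimitiveRoot (α ^ h) (p ^ (m + 2)) := by
    rw [← hm]; exact IsPrimitiveRoot.orderOf _
  have key := aux_main p hp hodd hw e (2 ^ r) he he' (by positivity)
    ((Nat.even_pow' (by omega)).2 even_two) hf g hg n m k (by omega) (α ^ h) hx
  constructor
  · intro h0
    apply key
    rw [h0]; simp
  · intro h0
    apply key
    rw [h0]; simp
end

section
/- Let p be an odd prime with 2^(p−1) ≢ 1 (mod p²), let e divide p − 1 with f = (p − 1)/e = 2^r for some r ≥ 1, let n ≥ 1, and let s be the generalized cyclotomic binary sequence of period p^n with parameter b. Then the linear complexity L of s over F₂ satisfies: L = p^n − (p−1)/2 − δ((p^n+1)/2) if 2 mod p ∈ D_0^(p), and L = p^n − δ((p^n+1)/2) if 2 mod p ∉ D_0^(p), where δ(t) = 1 if t is even and δ(t) = 0 if t is odd. -/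
open scoped Classical

/-- The characteristic set
`C₁^(p^n) = ⋃_{j=1}^{n} ⋃_{i=0}^{d_j/2-1} p^(n-j)·D_((i+b) mod d_j)^(p^j) ∪ {0}`,
where `p^(n-j)·D = { p^(n-j)·x mod p^n : x ∈ D }` (representatives `x ∈ [0, p^j)`). -/
def C1set (p e g n b : ℕ) : Set (ZMod (p ^ n)) :=
  {0} ∪ ⋃ j ∈ Set.Icc 1 n, ⋃ i ∈ Set.Iio (p ^ (j - 1) * ((p - 1) / e) / 2),
    (fun x : ZMod (p ^ j) => (p : ZMod (p ^ n)) ^ (n - j) * (x.val : ZMod (p ^ n))) ''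
      Dclass p e g j ((i + b) % (p ^ (j - 1) * ((p - 1) / e)))

/-- The generating polynomial `S(x) = Σ_{i=0}^{p^n-1} s_i·x^i ∈ F₂[x]` of the
generalized cyclotomic binary sequence `s` of period `p^n`, where `s_i = 1` iff
`i mod p^n ∈ C₁^(p^n)`. -/
noncomputable def Spoly (p e g n b : ℕ) : Polynomial (ZMod 2) :=
  ∑ i ∈ Finset.range (p ^ n),
    (if (i : ZMod (p ^ n)) ∈ C1set p e g n b then 1 else 0) * Polynomial.X ^ i

/-- The linear complexity `L = p^n − deg gcd(x^(p^n) − 1, S(x))` of the sequence,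
computed in `F₂[x]`. -/
noncomputable def linComplexity (p e g n b : ℕ) : ℕ :=
  p ^ n - (EuclideanDomain.gcd (Polynomial.X ^ (p ^ n) - 1) (Spoly p e g n b)).natDegree


namespace GCS

lemma g_pow_one {p : ℕ} (hp : p.Prime) (hodd : Odd p) {g : ℕ}
    (hg : orderOf (g : ZMod (p ^ 2)) = Nat.totient (p ^ 2)) (j : ℕ) (hj : 1 ≤ j) (s : ℕ) :
    g ^ s ≡ 1 [MOD p ^ j] ↔ p ^ (j - 1) * (p - 1) ∣ s := by
  have htot : Nat.totient (p ^ 2) = p * (p - 1) := by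
    rw [Nat.totient_prime_pow hp (by norm_num)]; simp
  have hpp := hp.two_le
  have h2 : ∀ s : ℕ, g ^ s ≡ 1 [MOD p ^ 2] ↔ p * (p - 1) ∣ s := by
    intro s
    rw [← htot, ← hg, orderOf_dvd_iff_pow_eq_one, ← ZMod.natCast_eq_natCast_iff]
    push_cast; rfl
  have hcop : Nat.Coprime g p := by
    have h := (h2 (p * (p - 1))).2 dvd_rfl
    have h' : g ^ (p * (p - 1)) ≡ 1 [MOD p] := h.of_dvd (dvd_pow_self p (by norm_num))
    rw [Nat.coprime_comm, hp.coprime_iff_not_dvd]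
    intro hd
    have h3 : g ^ (p * (p - 1)) ≡ 0 [MOD p] := by
      rw [Nat.modEq_zero_iff_dvd]
      exact dvd_pow hd (by apply Nat.mul_ne_zero <;> omega)
    have h4 := (h'.symm.trans h3)
    rw [Nat.modEq_zero_iff_dvd] at h4
    exact hp.one_lt.ne' (Nat.dvd_one.1 h4)
  have hcopj : Nat.Coprime g (p ^ j) := hcop.pow_right j
  constructor
  · intro h
    have h1 : g ^ s ≡ 1 [MOD p] := h.of_dvd (dvd_pow_self p (by omega))
    have h3 : g ^ (s * p) ≡ 1 [MOD p ^ 2] := by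
      have hd : (p : ℤ) ∣ (g : ℤ) ^ s - 1 := by
        have := (Nat.modEq_iff_dvd.1 h1.symm); push_cast at this; exact this
      have := dvd_sub_pow_of_dvd_sub hd 1
      refine (Nat.modEq_iff_dvd.2 ?_).symm
      push_cast
      simpa [pow_mul] using this
    have h4 : p - 1 ∣ s := by
      have := (h2 _).1 h3
      rw [mul_comm s p] at this
      exact Nat.dvd_of_mul_dvd_mul_left hp.pos this
    obtain ⟨w, rfl⟩ := h4
    have hf : g ^ (p - 1) ≡ 1 [MOD p] := by
      have := Nat.ModEq.pow_totient hcop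
      rwa [Nat.totient_prime hp] at this
    have hd : (p : ℤ) ∣ (g : ℤ) ^ (p - 1) - 1 := by
      have := (Nat.modEq_iff_dvd.1 hf.symm); push_cast at this; exact this
    obtain ⟨u, hu⟩ := hd
    have hpu : ¬ (p : ℤ) ∣ u := by
      rintro ⟨v, rfl⟩
      have : g ^ (p - 1) ≡ 1 [MOD p ^ 2] := by
        refine (Nat.modEq_iff_dvd.2 ?_).symm
        push_cast
        exact ⟨v, by rw [hu]; ring⟩
      have h5 := Nat.le_of_dvd (by omega) ((h2 _).1 this)
      nlinarith [Nat.sub_pos_of_lt hp.one_lt]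
    obtain ⟨k, rfl⟩ : ∃ k, j = k + 1 := ⟨j - 1, by omega⟩
    have hord := ZMod.orderOf_one_add_mul_prime hp (by rintro rfl; revert hodd; decide) u hpu k
    have h6 : ((1 : ZMod (p ^ (k + 1))) + p * u) = (g : ZMod (p ^ (k + 1))) ^ (p - 1) := by
      have : ((g : ℤ) ^ (p - 1)) = 1 + p * u := by linarith
      have := congrArg (Int.cast : ℤ → ZMod (p ^ (k + 1))) this
      push_cast at this
      exact this.symm
    have h7 : ((g : ZMod (p ^ (k + 1))) ^ (p - 1)) ^ w = 1 := by
      rw [← ZMod.natCast_eq_natCast_iff] at h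
      push_cast at h
      rw [← pow_mul]; exact h
    rw [← h6] at h7
    have h8 := orderOf_dvd_of_pow_eq_one h7
    rw [hord] at h8
    rw [mul_comm]
    exact Nat.mul_dvd_mul_left _ h8
  · rintro ⟨w, rfl⟩
    have := (Nat.ModEq.pow_totient hcopj).pow w
    rw [Nat.totient_prime_pow hp (by omega)] at this
    rw [pow_mul]
    simpa using this

lemma g_cop {p : ℕ} (hp : p.Prime) (hodd : Odd p) {g : ℕ}
    (hg : orderOf (g : ZMod (p ^ 2)) = Nat.totient (p ^ 2)) : Nat.Coprime g p := by
  have hpp := hp.two_le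
  have h' := (g_pow_one hp hodd hg 1 le_rfl (p ^ (1 - 1) * (p - 1))).2 dvd_rfl
  simp only [pow_one] at h'
  rw [Nat.coprime_comm, hp.coprime_iff_not_dvd]
  intro hd
  have h3 : g ^ (p ^ (1 - 1) * (p - 1)) ≡ 0 [MOD p] := by
    rw [Nat.modEq_zero_iff_dvd]
    exact dvd_pow hd (by simp; omega)
  have h4 := (h'.symm.trans h3)
  rw [Nat.modEq_zero_iff_dvd] at h4
  exact hp.one_lt.ne' (Nat.dvd_one.1 h4)

lemma g_pow_eq {p : ℕ} (hp : p.Prime) (hodd : Odd p) {g : ℕ}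
    (hg : orderOf (g : ZMod (p ^ 2)) = Nat.totient (p ^ 2)) (j : ℕ) (hj : 1 ≤ j) (s t : ℕ) :
    g ^ s ≡ g ^ t [MOD p ^ j] ↔ s ≡ t [MOD p ^ (j - 1) * (p - 1)] := by
  have hcopj : Nat.Coprime g (p ^ j) := (g_cop hp hodd hg).pow_right j
  wlog hst : s ≤ t generalizing s t with H
  · have := H t s (by omega)
    exact ⟨fun h => (this.1 h.symm).symm, fun h => (this.2 h.symm).symm⟩
  obtain ⟨k, rfl⟩ := Nat.exists_eq_add_of_le hst
  have h1 : s ≡ s + k [MOD p ^ (j - 1) * (p - 1)] ↔ p ^ (j - 1) * (p - 1) ∣ k := by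
    rw [Nat.modEq_iff_dvd]; push_cast
    rw [add_sub_cancel_left]; norm_cast
  rw [h1, ← g_pow_one hp hodd hg j hj]
  constructor
  · intro h
    rw [pow_add] at h
    have : g ^ s * 1 ≡ g ^ s * g ^ k [MOD p ^ j] := by simpa using h
    exact (Nat.ModEq.cancel_left_of_coprime (by
      rw [Nat.gcd_comm]; exact hcopj.pow_left s) this).symm
  · intro h
    rw [pow_add]
    simpa using (h.mul_left (g ^ s)).symm

lemma exists_g_pow {p : ℕ} (hp : p.Prime) (hodd : Odd p) {g : ℕ}
    (hg : orderOf (g : ZMod (p ^ 2)) = Nat.totient (p ^ 2)) (j : ℕ) (hj : 1 ≤ j) (x : ℕ)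
    (hx : Nat.Coprime x p) : ∃ s, x ≡ g ^ s [MOD p ^ j] := by
  have hcopj : Nat.Coprime g (p ^ j) := (g_cop hp hodd hg).pow_right j
  haveI : NeZero (p ^ j) := ⟨pow_ne_zero _ hp.ne_zero⟩
  let G : (ZMod (p ^ j))ˣ := ZMod.unitOfCoprime g hcopj
  have hpow : ∀ s : ℕ, G ^ s = 1 ↔ p ^ (j - 1) * (p - 1) ∣ s := by
    intro s
    rw [← g_pow_one hp hodd hg j hj, ← ZMod.natCast_eq_natCast_iff, Units.ext_iff]
    simp [G]
  have hord : orderOf G = Nat.card (ZMod (p ^ j))ˣ := by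
    rw [Nat.card_eq_fintype_card, ZMod.card_units_eq_totient, Nat.totient_prime_pow hp (by omega)]
    apply Nat.dvd_antisymm
    · exact orderOf_dvd_of_pow_eq_one ((hpow _).2 dvd_rfl)
    · exact (hpow _).1 (pow_orderOf_eq_one G)
  have htop : ZMod.unitOfCoprime x (hx.pow_right j) ∈ Subgroup.zpowers G := by
    rw [Subgroup.eq_top_of_card_eq (Subgroup.zpowers G) (by rw [Nat.card_zpowers, hord])]
    trivial
  rw [mem_zpowers_iff_mem_range_orderOf] at htop
  simp only [Finset.mem_image] at htop
  obtain ⟨s, -, hs⟩ := htop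
  refine ⟨s, ?_⟩
  rw [← ZMod.natCast_eq_natCast_iff]
  have := congrArg Units.val hs
  simpa [G] using this.symm

lemma level_unique {p : ℕ} (hp : p.Prime) {n j j' a a' : ℕ} (hj : 1 ≤ j) (hjn : j ≤ n)
    (hj'n : j' ≤ n) (ha : Nat.Coprime a p)
    (h : p ^ (n - j) * a ≡ p ^ (n - j') * a' [MOD p ^ n]) : j' ≥ j := by
  by_contra hlt
  push Not at hlt
  have h1 : p ^ (n - j) * a ≡ p ^ (n - j') * a' [MOD p ^ (n - j + 1)] :=
    h.of_dvd (pow_dvd_pow p (by omega))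
  have h2 : p ^ (n - j') * a' ≡ 0 [MOD p ^ (n - j + 1)] := by
    rw [Nat.modEq_zero_iff_dvd]
    exact Dvd.dvd.mul_right (pow_dvd_pow p (by omega)) _
  have h3 := h1.trans h2
  rw [Nat.modEq_zero_iff_dvd, pow_succ] at h3
  have h4 := Nat.dvd_of_mul_dvd_mul_left (pow_pos hp.pos _) h3
  exact (hp.coprime_iff_not_dvd.1 ha.symm) h4

lemma mem_C1 {p : ℕ} (hp : p.Prime) (hodd : Odd p) {g : ℕ}
    (hg : orderOf (g : ZMod (p ^ 2)) = Nat.totient (p ^ 2)) {e f : ℕ} (he : 0 < e) (hf0 : 0 < f)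
    (hf : (p - 1) / e = f) (hef : f * e = p - 1) {n j : ℕ} (hj : 1 ≤ j) (hjn : j ≤ n) (b s : ℕ) :
    ((p ^ (n - j) * g ^ s : ℕ) : ZMod (p ^ n)) ∈ C1set p e g n b ↔
      ∃ i < p ^ (j - 1) * f / 2, s ≡ i + b [MOD p ^ (j - 1) * f] := by
  have hgc := g_cop hp hodd hg
  have hval : ∀ (j' s' : ℕ), (p ^ (n - j') * ((g : ZMod (p ^ j')) ^ s').val) ≡
      p ^ (n - j') * g ^ s' [MOD p ^ (n - j') * p ^ j'] := by
    intro j' s'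
    apply Nat.ModEq.mul_left'
    have : ((g : ZMod (p ^ j')) ^ s') = ((g ^ s' : ℕ) : ZMod (p ^ j')) := by push_cast; rfl
    rw [this, ZMod.val_natCast]
    exact Nat.mod_modEq _ _
  unfold C1set Dclass
  rw [hf]
  simp only [Set.singleton_union, Set.mem_insert_iff, Set.mem_iUnion, Set.mem_image,
    Set.mem_Icc, Set.mem_Iio, Set.mem_setOf_eq, exists_prop]
  constructor
  · rintro (h0 | ⟨j', ⟨hj', hj'n⟩, i, hi, x, ⟨t, ht, rfl⟩, hx⟩)
    · exfalso
      rw [ZMod.natCast_eq_zero_iff] at h0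
      have : p ^ (n - j) * p ^ j ∣ p ^ (n - j) * g ^ s := by
        rw [← pow_add]; convert h0 using 2; omega
      have h4 := Nat.dvd_of_mul_dvd_mul_left (pow_pos hp.pos _) this
      have h5 : p ∣ g ^ s := (dvd_pow_self p (by omega)).trans h4
      exact (hp.coprime_iff_not_dvd.1 hgc.symm) (hp.dvd_of_dvd_pow h5)
    · have hx' : p ^ (n - j') * ((g : ZMod (p ^ j')) ^ (p ^ (j' - 1) * f * t +
          (i + b) % (p ^ (j' - 1) * f))).val ≡ p ^ (n - j) * g ^ s [MOD p ^ n] := by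
        rw [← ZMod.natCast_eq_natCast_iff]
        push_cast; push_cast at hx; exact hx
      have h1 := hval j' (p ^ (j' - 1) * f * t + (i + b) % (p ^ (j' - 1) * f))
      rw [← pow_add, Nat.sub_add_cancel hj'n] at h1
      have h2 := h1.symm.trans hx'
      have hjj : j' = j := le_antisymm
        (level_unique hp hj' hj'n hjn (hgc.pow_left _) h2)
        (level_unique hp hj hjn hj'n (hgc.pow_left _) h2.symm)
      subst hjj
      refine ⟨i, hi, ?_⟩
      have h3 : p ^ (n - j') * g ^ (p ^ (j' - 1) * f * t + (i + b) % (p ^ (j' - 1) * f)) ≡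
          p ^ (n - j') * g ^ s [MOD p ^ (n - j') * p ^ j'] := by
        rw [← pow_add, Nat.sub_add_cancel hj'n]; exact h2
      have h4 := Nat.ModEq.mul_left_cancel' (pow_pos hp.pos _).ne' h3
      rw [g_pow_eq hp hodd hg _ hj', ← hef, ← mul_assoc] at h4
      have h5 := h4.of_dvd (dvd_mul_right _ e)
      refine h5.symm.trans ?_
      simp [Nat.ModEq]
  · rintro ⟨i, hi, hs⟩
    right
    refine ⟨j, ⟨hj, hjn⟩, i, hi, _, ⟨(s / (p ^ (j - 1) * f)) % e, Nat.mod_lt _ he, rfl⟩, ?_⟩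
    have h1 := hval j (p ^ (j - 1) * f * ((s / (p ^ (j - 1) * f)) % e)
      + (i + b) % (p ^ (j - 1) * f))
    rw [← pow_add, Nat.sub_add_cancel hjn] at h1
    have h2 : p ^ (n - j) * g ^ (p ^ (j - 1) * f * ((s / (p ^ (j - 1) * f)) % e)
      + (i + b) % (p ^ (j - 1) * f)) ≡ p ^ (n - j) * g ^ s [MOD p ^ n] := by
      have h3 : p ^ n = p ^ (n - j) * p ^ j := by rw [← pow_add, Nat.sub_add_cancel hjn]
      rw [h3]
      apply Nat.ModEq.mul_left'
      rw [g_pow_eq hp hodd hg _ hj, ← hef, ← mul_assoc]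
      have h4 : s = p ^ (j - 1) * f * (s / (p ^ (j - 1) * f)) + (i + b) % (p ^ (j - 1) * f) := by
        conv_lhs => rw [← Nat.div_add_mod s (p ^ (j - 1) * f)]
        rw [hs]
      conv_rhs => rw [h4]
      apply Nat.ModEq.add_right
      apply Nat.ModEq.mul_left'
      exact Nat.mod_modEq _ _
    have h3 := h1.trans h2
    rw [← ZMod.natCast_eq_natCast_iff] at h3
    push_cast; push_cast at h3; exact h3

lemma window_swap {h s b o : ℕ} (hh : 0 < h) (ho : Odd o) :
    (∃ i < h, s ≡ i + b [MOD 2 * h]) ↔ ¬ ∃ i < h, h * o + s ≡ i + b [MOD 2 * h] := by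
  obtain ⟨c, hc, hsc⟩ : ∃ c < 2 * h, s ≡ c + b [MOD 2 * h] := by
    refine ⟨(s + (2 * h - 1) * b) % (2 * h), Nat.mod_lt _ (by omega), ?_⟩
    refine Nat.ModEq.symm ((Nat.ModEq.add_right b (Nat.mod_modEq _ _)).trans ?_)
    have : s + (2 * h - 1) * b + b = s + 2 * h * b := by
      obtain ⟨m, hm⟩ : ∃ m, 2 * h = m + 1 := ⟨2 * h - 1, by omega⟩
      rw [hm]; simp; ring
    rw [this]
    simp [Nat.ModEq]
  have hho : h * o + s ≡ (h + c) + b [MOD 2 * h] := by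
    obtain ⟨k, rfl⟩ := ho
    have h1 : h * (2 * k + 1) ≡ h [MOD 2 * h] := by
      have : h * (2 * k + 1) = h + 2 * h * k := by ring
      rw [this]; simp [Nat.ModEq]
    have := h1.add hsc
    rwa [← add_assoc] at this
  have key : ∀ i < 2 * h, ∀ x < 2 * h, x + b ≡ i + b [MOD 2 * h] → x = i := by
    intro i hi x hx hxi
    exact (Nat.ModEq.add_right_cancel' b hxi).eq_of_lt_of_lt hx hi
  by_cases hch : c < h
  · refine ⟨fun _ => ?_, fun _ => ⟨c, hch, hsc⟩⟩
    rintro ⟨i, hi, h2⟩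
    have := key i (by omega) (h + c) (by omega) (hho.symm.trans h2)
    omega
  · constructor
    · rintro ⟨i, hi, h2⟩
      have := key i (by omega) c hc (hsc.symm.trans h2)
      omega
    · intro hn
      exfalso
      apply hn
      refine ⟨c - h, by omega, hho.trans ?_⟩
      have : h + c + b = c - h + b + 2 * h := by omega
      rw [this]
      simp [Nat.ModEq]

lemma C1_swap {p : ℕ} (hp : p.Prime) (hodd : Odd p) {g : ℕ}
    (hg : orderOf (g : ZMod (p ^ 2)) = Nat.totient (p ^ 2)) {e f : ℕ} (he : 0 < e) (hf0 : 0 < f)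
    (hf : (p - 1) / e = f) (hef : f * e = p - 1) {h : ℕ} (hh : f = 2 * h) {n : ℕ} (b : ℕ)
    (x : ZMod (p ^ n)) (hx : x ≠ 0) :
    x ∈ C1set p e g n b ↔ ¬ ((g : ZMod (p ^ n)) ^ (p ^ (n - 1) * h) * x ∈ C1set p e g n b) := by
  have : NeZero (p ^ n) := ⟨pow_ne_zero _ hp.ne_zero⟩
  obtain ⟨a, rfl⟩ : ∃ a : ℕ, (a : ZMod (p ^ n)) = x := ⟨x.val, by simp⟩
  have ha : ¬ p ^ n ∣ a := by rwa [Ne, ZMod.natCast_eq_zero_iff] at hx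
  have ha0 : a ≠ 0 := by rintro rfl; simp at ha
  obtain ⟨k, y, hy, hay⟩ := Nat.exists_eq_pow_mul_and_not_dvd ha0 p hp.ne_one
  have hkn : k < n := by
    by_contra hk
    push Not at hk
    exact ha (hay ▸ Dvd.dvd.mul_right (pow_dvd_pow p hk) y)
  obtain ⟨j, hj, hjn, rfl⟩ : ∃ j, 1 ≤ j ∧ j ≤ n ∧ k = n - j := ⟨n - k, by omega, by omega, by omega⟩
  obtain ⟨s, hs⟩ := exists_g_pow hp hodd hg j hj y ((hp.coprime_iff_not_dvd.2 hy).symm)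
  have hxa : (a : ZMod (p ^ n)) = ((p ^ (n - j) * g ^ s : ℕ) : ZMod (p ^ n)) := by
    rw [ZMod.natCast_eq_natCast_iff, hay]
    have h3 : p ^ n = p ^ (n - j) * p ^ j := by rw [← pow_add, Nat.sub_add_cancel hjn]
    rw [h3]
    exact Nat.ModEq.mul_left' _ hs
  have h2 : (g : ZMod (p ^ n)) ^ (p ^ (n - 1) * h) * a =
      ((p ^ (n - j) * g ^ (p ^ (n - 1) * h + s) : ℕ) : ZMod (p ^ n)) := by
    rw [hxa]; push_cast; ring
  rw [h2, hxa, mem_C1 hp hodd hg he hf0 hf hef hj hjn, mem_C1 hp hodd hg he hf0 hf hef hj hjn]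
  have h4 : p ^ (j - 1) * f = 2 * (p ^ (j - 1) * h) := by rw [hh]; ring
  rw [h4, Nat.mul_div_cancel_left _ (by norm_num)]
  have h5 : p ^ (n - 1) * h = p ^ (j - 1) * h * p ^ (n - j) := by
    have : n - 1 = (j - 1) + (n - j) := by omega
    rw [this, pow_add]; ring
  rw [h5]
  exact window_swap (Nat.mul_pos (pow_pos hp.pos _) (by omega)) hodd.pow

lemma sum_C1_units {A : Type*} [AddCommMonoid A] {p : ℕ} (hp : p.Prime) (hodd : Odd p) {g : ℕ}
    (hg : orderOf (g : ZMod (p ^ 2)) = Nat.totient (p ^ 2)) {e f : ℕ} (he : 0 < e) (hf0 : 0 < f)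
    (hf : (p - 1) / e = f) (hef : f * e = p - 1) {n : ℕ} (hn : 1 ≤ n) [NeZero (p ^ n)] (b : ℕ)
    (F : ZMod (p ^ n) → A) :
    ∑ x with x ∈ C1set p e g n b ∧ Nat.Coprime x.val p, F x =
    ∑ i ∈ Finset.range (p ^ (n - 1) * f / 2), ∑ t ∈ Finset.range e,
      F ((g ^ (p ^ (n - 1) * f * t + i + b) : ℕ) : ZMod (p ^ n)) := by
  have hgc := g_cop hp hodd hg
  have hd0 : 0 < p ^ (n - 1) * f := Nat.mul_pos (pow_pos hp.pos _) hf0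
  rw [← Finset.sum_product']
  symm
  have hmem := fun s => mem_C1 hp hodd hg he hf0 hf hef hn le_rfl b s
  simp only [Nat.sub_self, pow_zero, one_mul] at hmem
  refine Finset.sum_nbij (fun q => ((g ^ (p ^ (n - 1) * f * q.2 + q.1 + b) : ℕ) : ZMod (p ^ n)))
    ?_ ?_ ?_ (fun _ _ => rfl)
  · rintro ⟨i, t⟩ hit
    simp only [Finset.mem_product, Finset.mem_range] at hit
    rw [Finset.mem_filter]
    refine ⟨Finset.mem_univ _, ?_, ?_⟩
    · rw [hmem]
      refine ⟨i, hit.1, ?_⟩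
      simp [Nat.ModEq, add_assoc]
    · have h1 : Nat.Coprime (g ^ (p ^ (n - 1) * f * t + i + b)) (p ^ n) := Nat.Coprime.pow _ _ hgc
      have h2 := (ZMod.val_coe_unit_coprime (ZMod.unitOfCoprime _ h1))
      rw [ZMod.coe_unitOfCoprime] at h2
      exact h2.coprime_dvd_right (dvd_pow_self p (by omega))
  · rintro ⟨i, t⟩ hit ⟨i', t'⟩ hit' heq
    simp only [Finset.coe_product, Set.mem_prod, Finset.coe_range, Set.mem_Iio] at hit hit'
    simp only at heq
    rw [ZMod.natCast_eq_natCast_iff, g_pow_eq hp hodd hg _ hn, ← hef, ← mul_assoc] at heq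
    have h1 := Nat.ModEq.add_right_cancel' b heq
    have hlt : ∀ i t, i < p ^ (n - 1) * f / 2 → t < e → 
        p ^ (n - 1) * f * t + i < p ^ (n - 1) * f * e := by
      intro i t hi ht
      have : p ^ (n - 1) * f * (t + 1) ≤ p ^ (n - 1) * f * e := Nat.mul_le_mul_left _ ht
      rw [mul_add, mul_one] at this
      omega
    have h2 := h1.eq_of_lt_of_lt (hlt _ _ hit.1 hit.2) (hlt _ _ hit'.1 hit'.2)
    have hi := congrArg (· % (p ^ (n - 1) * f)) h2
    simp only [Nat.mul_add_mod] at hi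
    rw [Nat.mod_eq_of_lt (by omega), Nat.mod_eq_of_lt (by omega)] at hi
    subst hi
    have ht : p ^ (n - 1) * f * t = p ^ (n - 1) * f * t' := by omega
    have := Nat.eq_of_mul_eq_mul_left hd0 ht
    rw [this]
  · intro x hx
    simp only [Finset.coe_filter, Finset.mem_univ, true_and, Set.mem_setOf_eq] at hx
    obtain ⟨hx, hxc⟩ := hx
    obtain ⟨s, hs⟩ := exists_g_pow hp hodd hg n hn _ hxc
    have hxs : x = ((g ^ s : ℕ) : ZMod (p ^ n)) := by
      rw [← (ZMod.natCast_eq_natCast_iff _ _ _).2 hs]; simp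
    rw [hxs, hmem] at hx
    obtain ⟨i, hi, hsi⟩ := hx
    -- choose u with s + D * u = d * t + i + b
    obtain ⟨t, ht⟩ : ∃ t, s ≡ p ^ (n - 1) * f * t + i + b [MOD p ^ (n - 1) * f * e] := by
      refine ⟨((s + (p ^ (n - 1) * f * e) * (i + b)) - (i + b)) / (p ^ (n - 1) * f), ?_⟩
      have hle : i + b ≤ s + (p ^ (n - 1) * f * e) * (i + b) := by
        have : 1 * (i + b) ≤ (p ^ (n - 1) * f * e) * (i + b) :=
          Nat.mul_le_mul_right _ (Nat.mul_pos hd0 he)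
        omega
      have hdv : p ^ (n - 1) * f ∣ s + (p ^ (n - 1) * f * e) * (i + b) - (i + b) := by
        apply (Nat.modEq_iff_dvd' hle).1
        refine hsi.symm.trans ?_
        rw [mul_assoc]
        simp [Nat.ModEq]
      rw [Nat.mul_div_cancel' hdv, add_assoc, Nat.sub_add_cancel hle]
      simp [Nat.ModEq]
    refine ⟨(i, t % e), ?_, ?_⟩
    · simp only [Finset.coe_product, Set.mem_prod, Finset.coe_range, Set.mem_Iio]
      exact ⟨hi, Nat.mod_lt _ he⟩
    · simp only
      rw [hxs, ZMod.natCast_eq_natCast_iff, g_pow_eq hp hodd hg _ hn, ← hef, ← mul_assoc]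
      refine Nat.ModEq.trans ?_ ht.symm
      apply Nat.ModEq.add_right
      apply Nat.ModEq.add_right
      apply Nat.ModEq.mul_left'
      exact Nat.mod_modEq _ _

/-- The value of the generating polynomial at `z`. -/
noncomputable def SS {Ω : Type*} [Field Ω] (p e g n b : ℕ) [NeZero (p ^ n)] (z : Ω) : Ω :=
  ∑ x : ZMod (p ^ n) with x ∈ C1set p e g n b, z ^ x.val

lemma eval_S {Ω : Type*} [Field Ω] [Algebra (ZMod 2) Ω] (p e g n b : ℕ) [NeZero (p ^ n)] (z : Ω) :
    Polynomial.aeval z (Spoly p e g n b) = SS p e g n b z := by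
  unfold Spoly SS
  rw [map_sum, Finset.sum_filter]
  refine Finset.sum_nbij (fun i : ℕ => (i : ZMod (p ^ n))) (fun _ _ => Finset.mem_univ _) ?_ ?_ ?_
  · intro i hi j hj hij
    simp only [Finset.coe_range, Set.mem_Iio] at hi hj
    simp only at hij
    rw [ZMod.natCast_eq_natCast_iff] at hij
    exact hij.eq_of_lt_of_lt hi hj
  · intro x _
    exact ⟨x.val, by simpa using ZMod.val_lt x, by simp⟩
  · intro i hi
    rw [Finset.mem_range] at hi
    simp only [ZMod.val_natCast, Nat.mod_eq_of_lt hi]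
    split_ifs <;> simp

lemma pow_val {Ω : Type*} [Monoid Ω] {P : ℕ} {z : Ω} (hz : z ^ P = 1) (a : ℕ) :
    z ^ (a : ZMod P).val = z ^ a := by
  rw [ZMod.val_natCast]
  conv_rhs => rw [← Nat.mod_add_div a P, pow_add, pow_mul, hz, one_pow, mul_one]

lemma sum_swap {A : Type*} [AddCommMonoid A] {p : ℕ} (hp : p.Prime) (hodd : Odd p) {g : ℕ}
    (hg : orderOf (g : ZMod (p ^ 2)) = Nat.totient (p ^ 2)) {e f : ℕ} (he : 0 < e) (hf0 : 0 < f)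
    (hf : (p - 1) / e = f) (hef : f * e = p - 1) {h : ℕ} (hh : f = 2 * h) {n : ℕ} [NeZero (p ^ n)]
    (b : ℕ) (E : ZMod (p ^ n) → A) :
    ∑ x with x ∈ C1set p e g n b, E x +
      ∑ x with x ∈ C1set p e g n b, E ((g : ZMod (p ^ n)) ^ (p ^ (n - 1) * h) * x)
      = ∑ x, E x + E 0 := by
  have hcop : Nat.Coprime g (p ^ n) := (g_cop hp hodd hg).pow_right n
  let v : (ZMod (p ^ n))ˣ := (ZMod.unitOfCoprime g hcop) ^ (p ^ (n - 1) * h)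
  have hv : (v : ZMod (p ^ n)) = (g : ZMod (p ^ n)) ^ (p ^ (n - 1) * h) := by simp [v]
  have hs := C1_swap hp hodd hg he hf0 hf hef hh (n := n) b
  rw [← hv] at hs ⊢
  rw [Finset.sum_filter, Finset.sum_filter]
  have h1 : ∑ x : ZMod (p ^ n), (if x ∈ C1set p e g n b then E (v * x) else 0) =
      ∑ y : ZMod (p ^ n), (if (Units.mulLeft v).symm y ∈ C1set p e g n b then E y else 0) := by
    rw [← Equiv.sum_comp (Units.mulLeft v)
      (fun y => if (Units.mulLeft v).symm y ∈ C1set p e g n b then E y else 0)]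
    apply Finset.sum_congr rfl
    intro x _
    rw [Equiv.symm_apply_apply]
    simp
  rw [h1, ← Finset.sum_add_distrib]
  have h2 : E 0 = ∑ x : ZMod (p ^ n), if x = 0 then E x else 0 := by simp
  rw [h2, ← Finset.sum_add_distrib]
  apply Finset.sum_congr rfl
  intro y _
  by_cases hy : y = 0
  · subst hy
    have : (0 : ZMod (p ^ n)) ∈ C1set p e g n b := by simp [C1set]
    simp [this]
  · have h3 := hs ((Units.mulLeft v).symm y) (by simpa using hy)
    have h4 : (v : ZMod (p ^ n)) * (Units.mulLeft v).symm y = y := by simp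
    rw [h4] at h3
    rw [if_neg hy]
    by_cases h5 : y ∈ C1set p e g n b
    · rw [if_pos h5, if_neg (by rw [h3]; simpa using h5)]
    · rw [if_neg h5, if_pos (h3.2 h5)]; simp

lemma card_C1 {p : ℕ} (hp : p.Prime) (hodd : Odd p) {g : ℕ}
    (hg : orderOf (g : ZMod (p ^ 2)) = Nat.totient (p ^ 2)) {e f : ℕ} (he : 0 < e) (hf0 : 0 < f)
    (hf : (p - 1) / e = f) (hef : f * e = p - 1) {h : ℕ} (hh : f = 2 * h) {n : ℕ} [NeZero (p ^ n)]
    (b : ℕ) : (Finset.univ.filter (fun x => x ∈ C1set p e g n b)).card = (p ^ n + 1) / 2 := by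
  have := sum_swap hp hodd hg he hf0 hf hef hh (n := n) b (fun _ => 1)
  simp only [Finset.sum_const, smul_eq_mul, mul_one, Finset.card_univ, ZMod.card] at this
  omega

lemma SS_swap {Ω : Type*} [Field Ω] [CharP Ω 2] {p : ℕ} (hp : p.Prime) (hodd : Odd p) {g : ℕ}
    (hg : orderOf (g : ZMod (p ^ 2)) = Nat.totient (p ^ 2)) {e f : ℕ} (he : 0 < e) (hf0 : 0 < f)
    (hf : (p - 1) / e = f) (hef : f * e = p - 1) {h : ℕ} (hh : f = 2 * h) {n : ℕ} [NeZero (p ^ n)]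
    (b : ℕ) {z : Ω} (hz : z ^ (p ^ n) = 1) (hz1 : z ≠ 1) :
    SS p e g n b z + SS p e g n b (z ^ (g ^ (p ^ (n - 1) * h))) = 1 := by
  have h1 := sum_swap hp hodd hg he hf0 hf hef hh (n := n) b (fun x => z ^ x.val)
  have h2 : ∀ x : ZMod (p ^ n), z ^ ((g : ZMod (p ^ n)) ^ (p ^ (n - 1) * h) * x).val =
      (z ^ (g ^ (p ^ (n - 1) * h))) ^ x.val := by
    intro x
    rw [← pow_mul, ← pow_val hz (g ^ (p ^ (n - 1) * h) * x.val)]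
    push_cast
    simp
  simp only [h2] at h1
  unfold SS
  rw [h1]
  have h3 : ∑ x : ZMod (p ^ n), z ^ x.val = ∑ i ∈ Finset.range (p ^ n), z ^ i := by
    symm
    refine Finset.sum_nbij (fun i : ℕ => (i : ZMod (p ^ n))) (fun _ _ => Finset.mem_univ _) ?_ ?_ ?_
    · intro i hi j hj hij
      simp only [Finset.coe_range, Set.mem_Iio] at hi hj
      simp only at hij
      rw [ZMod.natCast_eq_natCast_iff] at hij
      exact hij.eq_of_lt_of_lt hi hj
    · intro x _
      exact ⟨x.val, by simpa using ZMod.val_lt x, by simp⟩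
    · intro i hi
      rw [pow_val hz]
  have h4 : ∑ i ∈ Finset.range (p ^ n), z ^ i = 0 := by
    rw [geom_sum_eq hz1, hz]; simp
  rw [h3, h4]
  simp

lemma sum_periodic {A : Type*} [AddCommMonoid A] (φ : ℕ → A) (e : ℕ) (h : ∀ t, φ (t + e) = φ t)
    (s : ℕ) : ∑ t ∈ Finset.range e, φ (t + s) = ∑ t ∈ Finset.range e, φ t := by
  induction s with
  | zero => rfl
  | succ s ih =>
    rw [← ih]
    have h1 := Finset.sum_range_succ (fun t => φ (t + s)) e
    have h2 := Finset.sum_range_succ' (fun t => φ (t + s)) e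
    cases e with
    | zero => simp
    | succ e =>
      rw [Finset.sum_range_succ, Finset.sum_range_succ' (fun t => φ (t + s))]
      have : φ (e + (s + 1)) = φ (0 + s) := by
        rw [← h (0 + s)]; congr 1; omega
      rw [this]
      congr 1
      apply Finset.sum_congr rfl
      intro t _
      congr 1
      omega

lemma pow_congr {Ω : Type*} [Monoid Ω] {z : Ω} {p a a' : ℕ} (hz : z ^ p = 1)
    (h : a ≡ a' [MOD p]) : z ^ a = z ^ a' := by
  rw [← pow_val hz a, ← pow_val hz a', (ZMod.natCast_eq_natCast_iff _ _ _).2 h]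

lemma SS_shift {Ω : Type*} [Field Ω] {p : ℕ} (hp : p.Prime) (hodd : Odd p) {g : ℕ}
    (hg : orderOf (g : ZMod (p ^ 2)) = Nat.totient (p ^ 2)) {e f : ℕ} (he : 0 < e) (hf0 : 0 < f)
    (hf : (p - 1) / e = f) (hef : f * e = p - 1) {n : ℕ} (hn : 1 ≤ n) [NeZero (p ^ n)]
    (b : ℕ) {z : Ω} (hz : z ^ p = 1) (s : ℕ) :
    SS p e g n b (z ^ (g ^ (f * s))) = SS p e g n b z := by
  have hpp := hp.two_le
  have key : ∀ y : Ω, y ^ p = 1 → SS p e g n b y =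
      ∑ i ∈ Finset.range (p ^ (n - 1) * f / 2), ∑ t ∈ Finset.range e, y ^ (g ^ (f * t + i + b)) +
      ∑ x : ZMod (p ^ n) with x ∈ C1set p e g n b ∧ ¬ Nat.Coprime x.val p, 1 := by
    intro y hy
    have hyn : y ^ (p ^ n) = 1 := by
      obtain ⟨k, rfl⟩ : ∃ k, n = k + 1 := ⟨n - 1, by omega⟩
      rw [pow_succ', pow_mul, hy, one_pow]
    unfold SS
    rw [← Finset.sum_filter_add_sum_filter_not _ (fun x : ZMod (p ^ n) => Nat.Coprime x.val p),
      Finset.filter_filter, Finset.filter_filter, sum_C1_units hp hodd hg he hf0 hf hef hn]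
    congr 1
    · apply Finset.sum_congr rfl
      intro i _
      apply Finset.sum_congr rfl
      intro t _
      rw [pow_val hyn]
      apply pow_congr hy
      have := (g_pow_eq hp hodd hg 1 le_rfl (p ^ (n - 1) * f * t + i + b) (f * t + i + b)).2 ?_
      · simpa using this
      · simp only [Nat.sub_self, pow_zero, one_mul]
        apply Nat.ModEq.add_right
        apply Nat.ModEq.add_right
        have h1 : p ≡ 1 [MOD p - 1] := by
          have : p = 1 + (p - 1) := by omega
          conv_lhs => rw [this]
          simp [Nat.ModEq]
        have h2 := (h1.pow (n - 1)).mul_right (f * t)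
        simpa [mul_assoc] using h2
    · apply Finset.sum_congr rfl
      intro x hx
      simp only [Finset.mem_filter] at hx
      have hd : p ∣ x.val := by
        by_contra h
        exact hx.2.2 (hp.coprime_iff_not_dvd.2 h).symm
      obtain ⟨c, hc⟩ := hd
      rw [hc, pow_mul, hy, one_pow]
  rw [key z hz, key (z ^ (g ^ (f * s))) (by rw [← pow_mul, mul_comm, pow_mul, hz, one_pow])]
  congr 1
  apply Finset.sum_congr rfl
  intro i _
  rw [← sum_periodic (fun t => z ^ (g ^ (f * t + i + b))) e ?_ s]
  · apply Finset.sum_congr rfl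
    intro t _
    rw [← pow_mul, ← pow_add]
    congr 2
    ring
  · intro t
    apply pow_congr hz
    have := (g_pow_eq hp hodd hg 1 le_rfl (f * (t + e) + i + b) (f * t + i + b)).2 ?_
    · simpa using this
    · simp only [Nat.sub_self, pow_zero, one_mul]
      have : f * (t + e) + i + b = f * t + i + b + (p - 1) := by rw [← hef]; ring
      rw [this]
      simp [Nat.ModEq]

lemma SS_shift' {Ω : Type*} [Field Ω] {p : ℕ} (hp : p.Prime) (hodd : Odd p) {g : ℕ}
    (hg : orderOf (g : ZMod (p ^ 2)) = Nat.totient (p ^ 2)) {e f : ℕ} (he : 0 < e) (hf0 : 0 < f)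
    (hf : (p - 1) / e = f) (hef : f * e = p - 1) {n : ℕ} (hn : 1 ≤ n) [NeZero (p ^ n)]
    (b : ℕ) {z : Ω} (hz : z ^ p = 1) {s s' : ℕ} (hs : s ≡ s' [MOD f]) :
    SS p e g n b (z ^ (g ^ s)) = SS p e g n b (z ^ (g ^ s')) := by
  wlog hss : s ≤ s' generalizing s s' with H
  · exact (H hs.symm (by omega)).symm
  obtain ⟨u, hu⟩ := (Nat.modEq_iff_dvd' hss).1 hs
  have : s' = s + f * u := by omega
  rw [this, pow_add, pow_mul]
  rw [SS_shift hp hodd hg he hf0 hf hef hn b (by rw [← pow_mul, mul_comm, pow_mul, hz, one_pow])]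

lemma SS_sq {Ω : Type*} [Field Ω] [CharP Ω 2] (p e g n b : ℕ) [NeZero (p ^ n)] (z : Ω) :
    SS p e g n b (z ^ 2) = SS p e g n b z ^ 2 := by
  unfold SS
  rw [sum_pow_char 2]
  apply Finset.sum_congr rfl
  intro x _
  rw [← pow_mul, ← pow_mul, mul_comm]

lemma SS_two_pow {Ω : Type*} [Field Ω] [CharP Ω 2] (p e g n b : ℕ) [NeZero (p ^ n)] (z : Ω)
    (k : ℕ) : SS p e g n b (z ^ (2 ^ k)) = SS p e g n b z ^ (2 ^ k) := by
  induction k with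
  | zero => simp
  | succ k ih => rw [pow_succ, pow_mul, SS_sq, ih, ← pow_mul]

/-- At a primitive `p`-th root of unity, when `2 ∉ D_0`. -/
lemma SS_ne_zero_p {Ω : Type*} [Field Ω] [CharP Ω 2] {p : ℕ} (hp : p.Prime) (hodd : Odd p) {g : ℕ}
    (hg : orderOf (g : ZMod (p ^ 2)) = Nat.totient (p ^ 2)) {e f r : ℕ} (he : 0 < e)
    (hr : 1 ≤ r) (hfr : f = 2 ^ r)
    (hf : (p - 1) / e = f) (hef : f * e = p - 1) {n : ℕ} (hn : 1 ≤ n) [NeZero (p ^ n)]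
    (b : ℕ) {z : Ω} (hz : z ^ p = 1) (hz1 : z ≠ 1)
    (h2 : (2 : ZMod (p ^ 1)) ∉ Dclass p e g 1 0) : SS p e g n b z ≠ 0 := by
  intro h0
  have hf0 : 0 < f := by rw [hfr]; positivity
  have hp2 : Nat.Coprime 2 p := by
    rw [Nat.coprime_comm]; exact (Nat.coprime_two_right).2 hodd
  obtain ⟨l, hl⟩ := exists_g_pow hp hodd hg 1 le_rfl 2 hp2
  have hfl : ¬ f ∣ l := by
    rintro ⟨u, rfl⟩
    apply h2
    refine ⟨u % e, Nat.mod_lt _ he, ?_⟩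
    have h3 : 2 ≡ g ^ (f * (u % e)) [MOD p ^ 1] := by
      refine hl.trans ?_
      rw [g_pow_eq hp hodd hg 1 le_rfl, Nat.sub_self, pow_zero, one_mul, ← hef]
      apply Nat.ModEq.mul_left'
      exact (Nat.mod_modEq _ _).symm
    rw [← ZMod.natCast_eq_natCast_iff] at h3
    push_cast at h3
    rw [hf]
    simpa using h3
  have hl0 : l ≠ 0 := by rintro rfl; simp at hfl
  obtain ⟨a, o, ho, hao⟩ := Nat.exists_eq_two_pow_mul_odd hl0
  have har : a < r := by
    by_contra hc
    push Not at hc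
    apply hfl
    rw [hao, hfr]
    exact Dvd.dvd.mul_right (pow_dvd_pow 2 hc) o
  obtain ⟨h, hh⟩ : ∃ h, h = 2 ^ (r - 1) := ⟨_, rfl⟩
  have hfh : f = 2 * h := by
    rw [hh, hfr, ← pow_succ']; congr 1; omega
  have hlk : l * 2 ^ (r - 1 - a) = h * o := by
    rw [hao, hh]
    have : r - 1 = a + (r - 1 - a) := by omega
    conv_rhs => rw [this, pow_add]
    ring
  have h3 : SS p e g n b (z ^ (2 ^ (2 ^ (r - 1 - a)))) = 0 := by
    rw [SS_two_pow, h0, zero_pow (by positivity)]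
  have h4 : z ^ (2 ^ (2 ^ (r - 1 - a))) = z ^ (g ^ (h * o)) := by
    apply pow_congr hz
    rw [← hlk, pow_mul]
    rw [pow_one] at hl
    exact hl.pow _
  have hodm : ∀ o, Odd o → h * o ≡ h [MOD f] := by
    rintro o ⟨k, rfl⟩
    have : h * (2 * k + 1) = h + f * k := by rw [hfh]; ring
    rw [this]; simp [Nat.ModEq]
  have h5 : h * o ≡ p ^ (n - 1) * h [MOD f] := by
    rw [mul_comm (p ^ (n - 1)) h]
    exact (hodm o ho).trans (hodm _ hodd.pow).symm
  rw [h4, SS_shift' hp hodd hg he hf0 hf hef hn b hz h5] at h3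
  have hzn : z ^ (p ^ n) = 1 := by
    obtain ⟨k, rfl⟩ : ∃ k, n = k + 1 := ⟨n - 1, by omega⟩
    rw [pow_succ', pow_mul, hz, one_pow]
  have h6 := SS_swap hp hodd hg he hf0 hf hef hfh b hzn hz1
  rw [h0, h3] at h6
  simp at h6

/-- At a primitive `p`-th root of unity, when `2 ∈ D_0`. -/
lemma SS_zero_or_one {Ω : Type*} [Field Ω] [CharP Ω 2] {p : ℕ} (hp : p.Prime) (hodd : Odd p) {g : ℕ}
    (hg : orderOf (g : ZMod (p ^ 2)) = Nat.totient (p ^ 2)) {e f : ℕ} (he : 0 < e)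
    (hf0 : 0 < f)
    (hf : (p - 1) / e = f) (hef : f * e = p - 1) {n : ℕ} (hn : 1 ≤ n) [NeZero (p ^ n)]
    (b : ℕ) {z : Ω} (hz : z ^ p = 1)
    (h2 : (2 : ZMod (p ^ 1)) ∈ Dclass p e g 1 0) : SS p e g n b z = 0 ∨ SS p e g n b z = 1 := by
  obtain ⟨t, -, ht⟩ := h2
  have h3 : 2 ≡ g ^ (f * t) [MOD p ^ 1] := by
    rw [← ZMod.natCast_eq_natCast_iff]
    push_cast
    rw [hf] at ht
    simpa using ht
  rw [pow_one] at h3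
  have h4 := SS_sq p e g n b z
  rw [pow_congr hz h3, SS_shift hp hodd hg he hf0 hf hef hn b hz] at h4
  have h5 : SS p e g n b z * (SS p e g n b z - 1) = 0 := by linear_combination -h4
  rcases mul_eq_zero.1 h5 with h | h
  · exact Or.inl h
  · exact Or.inr (sub_eq_zero.1 h)

/-- Independence of powers of a primitive `p^m`-th root of unity. -/
lemma alg_indep {Ω : Type*} [Field Ω] [CharP Ω 2] {p : ℕ} (hp : p.Prime) (hodd : Odd p)
    (hw : ¬ (2 ^ (p - 1) ≡ 1 [MOD p ^ 2])) {k : ℕ} (hk : 1 ≤ k) {z : Ω}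
    (hz : z ^ (p ^ (k + 1)) = 1) (hz1 : z ^ (p ^ k) ≠ 1)
    {ι : Type*} (X : Finset ι) (v : ι → ℕ) (h0 : ∑ x ∈ X, z ^ v x = 0) :
    ∑ x ∈ X with v x % p ^ k = 1, z ^ v x = 0 := by
  have hpp := hp.two_le
  have hN : 1 < p ^ k := Nat.one_lt_pow (by omega) hp.one_lt
  let K : Subfield Ω := RingHom.eqLocusField (iterateFrobenius Ω 2 (p - 1)) (RingHom.id Ω)
  have hK : ∀ x : Ω, x ∈ K ↔ x ^ (2 ^ (p - 1)) = x := by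
    intro x
    rw [RingHom.mem_eqLocusField]
    simp [iterateFrobenius_def]
  have hap : (z ^ p ^ k) ^ p = 1 := by rw [← pow_mul, ← pow_succ, hz]
  have h2p : 2 ^ (p - 1) ≡ 1 [MOD p] := by
    have := Nat.ModEq.pow_totient (x := 2) (n := p)
      (by rw [Nat.coprime_comm]; exact (Nat.coprime_two_right).2 hodd)
    rwa [Nat.totient_prime hp] at this
  have haK : z ^ p ^ k ∈ K := by
    rw [hK]
    simpa using pow_congr hap h2p
  let α : K := ⟨z ^ p ^ k, haK⟩
  have hαm : algebraMap K Ω α = z ^ p ^ k := rfl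
  have hα : ∀ y : K, y ^ p ≠ α := by
    intro y hy
    have hy' : (y : Ω) ^ p = z ^ p ^ k := by
      have := congrArg (Subtype.val) hy
      simpa [α] using this
    have hy2 : (y : Ω) ^ (p ^ (1 + 1)) = 1 := by
      rw [pow_succ, pow_one, pow_mul, hy', hap]
    have hy1 : ¬ (y : Ω) ^ (p ^ 1) = 1 := by rw [pow_one, hy']; exact hz1
    have : Fact p.Prime := ⟨hp⟩
    have hord := orderOf_eq_prime_pow hy1 hy2
    have hyne : (y : Ω) ≠ 0 := by
      intro h
      rw [h, zero_pow (by positivity)] at hy2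
      exact zero_ne_one hy2
    have hyK := (hK y).1 y.2
    have h3 : (y : Ω) ^ (2 ^ (p - 1) - 1) = 1 := by
      have h4 : (y : Ω) * (y : Ω) ^ (2 ^ (p - 1) - 1) = y * 1 := by
        rw [← pow_succ', Nat.sub_add_cancel Nat.one_le_two_pow, hyK, mul_one]
      exact mul_left_cancel₀ hyne h4
    have h5 := orderOf_dvd_of_pow_eq_one h3
    rw [hord] at h5
    apply hw
    exact ((Nat.modEq_iff_dvd' Nat.one_le_two_pow).2 h5).symm
  have hirr := X_pow_sub_C_irreducible_of_prime_pow hp (by rintro rfl; revert hodd; decide) k hα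
  have hmon : (Polynomial.X ^ p ^ k - Polynomial.C α : Polynomial K).Monic :=
    Polynomial.monic_X_pow_sub_C α (by omega)
  have hmin := minpoly.eq_of_irreducible_of_monic (x := z) hirr (by
    simp [hαm]) hmon
  let Q : Polynomial K := ∑ x ∈ X, Polynomial.monomial (v x % p ^ k) (α ^ (v x / p ^ k))
  have hzv : ∀ a : ℕ, z ^ a = (z ^ p ^ k) ^ (a / p ^ k) * z ^ (a % p ^ k) := by
    intro a
    rw [← pow_mul, ← pow_add, Nat.div_add_mod]
  have hQ0 : Polynomial.aeval z Q = 0 := by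
    rw [← h0]
    simp only [Q, map_sum]
    apply Finset.sum_congr rfl
    intro x _
    rw [Polynomial.aeval_monomial, hzv (v x)]
    simp [hαm]
  have hdeg : Q.degree < (minpoly K z).degree := by
    rw [← hmin, Polynomial.degree_X_pow_sub_C (by omega)]
    refine (Polynomial.degree_sum_le _ _).trans_lt ?_
    rw [Finset.sup_lt_iff (WithBot.bot_lt_coe _)]
    intro x _
    refine (Polynomial.degree_monomial_le _ _).trans_lt ?_
    exact_mod_cast Nat.mod_lt _ (by omega)
  have hQ : Q = 0 := Polynomial.eq_zero_of_dvd_of_degree_lt (minpoly.dvd K z hQ0) hdeg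
  have hc := congrArg (fun q : Polynomial K => ((q.coeff 1 : K) : Ω)) hQ
  simp only [Q, Polynomial.finsetSum_coeff, Polynomial.coeff_monomial, Polynomial.coeff_zero] at hc
  rw [← Finset.sum_filter] at hc
  have hc' : ∑ x ∈ X with v x % p ^ k = 1, (z ^ p ^ k) ^ (v x / p ^ k) = 0 := by
    have := hc
    push_cast at this
    simpa [α] using this
  rw [← zero_mul z, ← hc', Finset.sum_mul]
  apply Finset.sum_congr rfl
  intro x hx
  rw [Finset.mem_filter] at hx
  rw [hzv (v x), hx.2, pow_one]

lemma run_sum_ne {Ω : Type*} [Field Ω] {p : ℕ} (hp : p.Prime) (hodd : Odd p) {ρ : Ω}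
    (hρ : ρ ^ p = 1) (hρ1 : ρ ≠ 1) {D D' q : ℕ} (hD' : 0 < D') (hD : D = 2 * D')
    (hq : Odd q) (hpq : p ∣ q) (b : ℕ) :
    ∑ i ∈ Finset.range (D' * q) with D ∣ i + b, ρ ^ ((i + b) / D) ≠ 0 := by
  have hD0 : 0 < D := by omega
  set w0 := (b + (D - 1)) / D with hw0
  set w1 := (b + D' * q + (D - 1)) / D with hw1
  have hlow : ∀ x w : ℕ, (x + (D - 1)) / D ≤ w ↔ x ≤ D * w := by
    intro x w
    rw [Nat.div_le_iff_le_mul_add_pred hD0]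
    omega
  have h1 : ∑ i ∈ Finset.range (D' * q) with D ∣ i + b, ρ ^ ((i + b) / D) =
      ∑ w ∈ Finset.Ico w0 w1, ρ ^ w := by
    refine Finset.sum_bij' (fun i _ => (i + b) / D) (fun w _ => D * w - b) ?_ ?_ ?_ ?_ ?_
    · intro i hi
      simp only [Finset.mem_filter, Finset.mem_range] at hi
      obtain ⟨hi, w, hw⟩ := hi
      rw [hw, Nat.mul_div_cancel_left _ hD0, Finset.mem_Ico]
      constructor
      · rw [hw0, hlow]; omega
      · rw [← not_le, hw1, hlow]; omega
    · intro w hw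
      rw [Finset.mem_Ico] at hw
      have ha := (hlow b w).1 hw.1
      have hb := hw.2
      rw [← not_le, hw1, hlow] at hb
      simp only [Finset.mem_filter, Finset.mem_range]
      exact ⟨by omega, by rw [Nat.sub_add_cancel ha]; exact dvd_mul_right _ _⟩
    · intro i hi
      simp only [Finset.mem_filter, Finset.mem_range] at hi
      rw [Nat.mul_div_cancel' hi.2]; omega
    · intro w hw
      rw [Finset.mem_Ico] at hw
      have ha := (hlow b w).1 hw.1
      rw [Nat.sub_add_cancel ha, Nat.mul_div_cancel_left _ hD0]
    · intro i _; rfl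
  rw [h1, Finset.sum_Ico_eq_sum_range]
  have hρ0 : ρ ≠ 0 := by
    rintro rfl
    rw [zero_pow hp.ne_zero] at hρ
    exact zero_ne_one hρ
  simp only [pow_add]
  rw [← Finset.mul_sum, geom_sum_eq hρ1]
  refine mul_ne_zero (pow_ne_zero _ hρ0) (div_ne_zero ?_ (sub_ne_zero.2 hρ1))
  rw [sub_ne_zero]
  intro hL
  have : Fact p.Prime := ⟨hp⟩
  have hord := orderOf_eq_prime hρ hρ1
  have hdv := orderOf_dvd_of_pow_eq_one hL
  rw [hord] at hdv
  -- bounds on w1 - w0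
  have b1 := (hlow b w0).1 le_rfl
  have b2 := (hlow (b + D' * q) w1).1 le_rfl
  have b3 : D * w0 ≤ b + (D - 1) := Nat.mul_div_le _ _
  have b4 : D * w1 ≤ b + D' * q + (D - 1) := Nat.mul_div_le _ _
  have hle : w0 ≤ w1 := Nat.div_le_div_right (by omega)
  obtain ⟨L, hL'⟩ := Nat.exists_eq_add_of_le hle
  rw [hL', Nat.add_sub_cancel_left] at hdv
  rw [hL', mul_add] at b2 b4
  have c1 : D' * q < D' * (2 * L + 2) := by
    have : D' * (2 * L + 2) = D * L + D := by rw [hD]; ring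
    omega
  have c2 : D' * (2 * L) < D' * (q + 2) := by
    have h3 : D' * (2 * L) = D * L := by rw [hD]; ring
    have h4 : D' * (q + 2) = D' * q + D := by rw [hD]; ring
    omega
  have c1' := Nat.lt_of_mul_lt_mul_left c1
  have c2' := Nat.lt_of_mul_lt_mul_left c2
  obtain ⟨m, rfl⟩ := hq
  have hp1 := hp.one_lt
  have h2L : p ∣ 2 * L := Dvd.dvd.mul_left hdv 2
  have : 2 * L + 1 = 2 * m + 1 ∨ 2 * L = 2 * m + 1 + 1 := by omega
  rcases this with h | h
  · rw [← h, ← Nat.dvd_add_iff_right h2L] at hpq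
    exact hp1.ne' (Nat.dvd_one.1 hpq)
  · rw [h, ← Nat.dvd_add_iff_right hpq] at h2L
    exact hp1.ne' (Nat.dvd_one.1 h2L)

lemma inner_sum {A : Type*} [AddCommMonoid A] {e q w : ℕ} (he : 0 < e) (hq : q ≡ 1 [MOD e])
    (a : A) : ∑ t ∈ Finset.range e, (if e ∣ q * t + w then a else 0) = a := by
  have hiff : ∀ t, e ∣ q * t + w ↔ t + w ≡ 0 [MOD e] := by
    intro t
    rw [← Nat.modEq_zero_iff_dvd]
    have h1 : q * t + w ≡ t + w [MOD e] := by
      simpa using (hq.mul_right t).add_right w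
    exact ⟨fun h => h1.symm.trans h, fun h => h1.trans h⟩
  simp only [hiff]
  have h0 : (w * (e - 1)) % e + w ≡ 0 [MOD e] := by
    refine (Nat.ModEq.add_right w (Nat.mod_modEq _ _)).trans ?_
    obtain ⟨k, rfl⟩ : ∃ k, e = k + 1 := ⟨e - 1, by omega⟩
    have : w * (k + 1 - 1) + w = (k + 1) * w := by simp; ring
    rw [this, Nat.modEq_zero_iff_dvd]
    exact dvd_mul_right _ _
  rw [Finset.sum_eq_single ((w * (e - 1)) % e)]
  · rw [if_pos h0]
  · intro t ht hne
    rw [if_neg]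
    intro h
    apply hne
    rw [Finset.mem_range] at ht
    exact (Nat.ModEq.add_right_cancel' w (h.trans h0.symm)).eq_of_lt_of_lt ht (Nat.mod_lt _ he)
  · intro h
    exact absurd (Finset.mem_range.2 (Nat.mod_lt _ he)) h

/-- No zeros at roots of unity of order `p^m`, `m ≥ 2`. -/
lemma SS_ne_zero_high {Ω : Type*} [Field Ω] [CharP Ω 2] {p : ℕ} (hp : p.Prime) (hodd : Odd p)
    (hw : ¬ (2 ^ (p - 1) ≡ 1 [MOD p ^ 2])) {g : ℕ}
    (hg : orderOf (g : ZMod (p ^ 2)) = Nat.totient (p ^ 2)) {e f : ℕ} (he : 0 < e) (hf0 : 0 < f)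
    (hf : (p - 1) / e = f) (hef : f * e = p - 1) {h : ℕ} (hh : f = 2 * h) {n : ℕ} [NeZero (p ^ n)]
    (b : ℕ) {k : ℕ} (hk : 1 ≤ k) (hkn : k + 1 ≤ n) {z : Ω}
    (hz : z ^ (p ^ (k + 1)) = 1) (hz1 : z ^ (p ^ k) ≠ 1) : SS p e g n b z ≠ 0 := by
  intro h0
  have hpp := hp.two_le
  have hgc := g_cop hp hodd hg
  have hg0 : 0 < g := by
    rcases Nat.eq_zero_or_pos g with h | h
    · subst h
      have := (Nat.coprime_zero_left p).1 hgc
      omega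
    · exact h
  have hN : 1 < p ^ k := Nat.one_lt_pow (by omega) hp.one_lt
  have hzn : z ^ (p ^ n) = 1 := by
    have : p ^ n = p ^ (k + 1) * p ^ (n - (k + 1)) := by rw [← pow_add]; congr 1; omega
    rw [this, pow_mul, hz, one_pow]
  have hz0 : z ≠ 0 := by
    rintro rfl
    rw [zero_pow (pow_ne_zero _ hp.ne_zero)] at hz
    exact zero_ne_one hz
  have h1 := alg_indep hp hodd hw hk hz hz1 _ _ h0
  have h2 : ∑ x : ZMod (p ^ n) with x ∈ C1set p e g n b ∧ Nat.Coprime x.val p,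
      (if x.val % p ^ k = 1 then z ^ x.val else 0) = 0 := by
    rw [← Finset.sum_filter]
    refine Eq.trans ?_ h1
    apply Finset.sum_congr _ (fun _ _ => rfl)
    ext x
    simp only [Finset.mem_filter, Finset.mem_univ, true_and]
    refine ⟨fun hx => ⟨hx.1.1, hx.2⟩, fun hx => ⟨⟨hx.1, ?_⟩, hx.2⟩⟩
    rw [Nat.coprime_comm, hp.coprime_iff_not_dvd]
    intro hd
    have h3 : p ∣ x.val % p ^ k := (Nat.dvd_mod_iff (dvd_pow_self p (by omega))).2 hd
    rw [hx.2] at h3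
    exact hp.one_lt.ne' (Nat.dvd_one.1 h3)
  rw [sum_C1_units hp hodd hg he hf0 hf hef (by omega)] at h2
  -- the constants
  set D := p ^ (k - 1) * f with hD
  set D' := p ^ (k - 1) * h with hD'
  set q := p ^ (n - k) with hq
  have hDD : D = 2 * D' := by rw [hD, hD', hh]; ring
  have hDpos : 0 < D' := Nat.mul_pos (pow_pos hp.pos _) (by omega)
  have hDe : p ^ (k - 1) * (p - 1) = D * e := by rw [hD, ← hef]; ring
  have hd : p ^ (n - 1) * f = D * q := by
    have : n - 1 = (k - 1) + (n - k) := by omega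
    rw [this, pow_add, hD, hq]; ring
  have hpq : p ∣ q := dvd_pow_self p (by omega)
  have hqe : q ≡ 1 [MOD e] := by
    have h1 : p ≡ 1 [MOD p - 1] := by
      have : p = 1 + (p - 1) := by omega
      conv_lhs => rw [this]
      simp [Nat.ModEq]
    have h2 := (h1.of_dvd ⟨f, by rw [← hef]; ring⟩ : p ≡ 1 [MOD e]).pow (n - k)
    simpa using h2
  -- omega
  have hgM : g ^ (D * e) ≡ 1 [MOD p ^ k] := by
    rw [g_pow_one hp hodd hg k hk, hDe]
  have hgM1 : 1 ≤ g ^ (D * e) := Nat.one_le_pow _ _ hg0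
  set ω := z ^ (g ^ (D * e) - 1) with hω
  have hωp : ω ^ p = 1 := by
    obtain ⟨c, hc⟩ := (Nat.modEq_iff_dvd' hgM1).1 hgM.symm
    rw [hω, hc, ← pow_mul]
    have : p ^ k * c * p = p ^ (k + 1) * c := by ring
    rw [this, pow_mul, hz, one_pow]
  have hω1 : ω ≠ 1 := by
    intro hc
    have : Fact p.Prime := ⟨hp⟩
    have hord := orderOf_eq_prime_pow hz1 hz
    have h3 := orderOf_dvd_of_pow_eq_one hc
    rw [hord] at h3
    have h4 := ((Nat.modEq_iff_dvd' hgM1).2 h3).symm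
    rw [g_pow_one hp hodd hg (k + 1) (by omega), ← hDe, Nat.add_sub_cancel] at h4
    have h5 := Nat.le_of_dvd (Nat.mul_pos (pow_pos hp.pos _) (by omega)) h4
    have h6 := Nat.le_of_mul_le_mul_right h5 (by omega)
    exact absurd h6 (not_le.2 (Nat.pow_lt_pow_right hp.one_lt (by omega)))
  have hzg : z ^ (g ^ (D * e)) = z * ω := by
    rw [hω, ← pow_succ', Nat.sub_add_cancel hgM1]
  have hωg : ω ^ (g ^ (D * e)) = ω := by
    have := pow_congr hωp (hgM.of_dvd (dvd_pow_self p (by omega)))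
    simpa using this
  have hpowω : ∀ c, z ^ (g ^ (D * e * c)) = z * ω ^ c := by
    intro c
    induction c with
    | zero => simp
    | succ c ih =>
      have h3 : D * e * (c + 1) = D * e * c + D * e := by ring
      rw [h3, pow_add, pow_mul, ih, mul_pow, hzg, ← pow_mul, mul_comm c, pow_mul, hωg]
      ring
  -- rho
  set ρ := ω ^ ((p - 1) * f) with hρ
  have hρp : ρ ^ p = 1 := by rw [hρ, ← pow_mul, mul_comm, pow_mul, hωp, one_pow]
  have hρe : ρ ^ e = ω := by
    have h3 : (p - 1) * f * e ≡ 1 [MOD p] := by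
      rw [mul_assoc, hef]
      obtain ⟨c, rfl⟩ : ∃ c, p = c + 2 := ⟨p - 2, by omega⟩
      have : (c + 2 - 1) * (c + 2 - 1) = 1 + (c + 2) * c := by simp; ring
      rw [this]; simp [Nat.ModEq]
    rw [hρ, ← pow_mul, pow_congr hωp h3, pow_one]
  have hρ1 : ρ ≠ 1 := by
    intro hc
    rw [hc, one_pow] at hρe
    exact hω1 hρe.symm
  have h3 := run_sum_ne hp hodd hρp hρ1 hDpos hDD (hodd.pow : Odd (p ^ (n - k))) hpq b
  apply h3
  rw [← hq]
  have h4 : z * ∑ i ∈ Finset.range (D' * q) with D ∣ i + b, ρ ^ ((i + b) / D) = 0 := by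
    rw [← h2, hd]
    have h5 : D * q / 2 = D' * q := by rw [hDD, mul_assoc, Nat.mul_div_cancel_left _ (by norm_num)]
    rw [h5, Finset.sum_filter, Finset.mul_sum]
    apply Finset.sum_congr rfl
    intro i _
    have hcond : ∀ s : ℕ, (((g ^ s : ℕ) : ZMod (p ^ n)).val % p ^ k = 1) ↔ D * e ∣ s := by
      intro s
      rw [ZMod.val_natCast, Nat.mod_mod_of_dvd _ (pow_dvd_pow p (by omega : k ≤ n)), ← hDe,
        ← g_pow_one hp hodd hg k hk, Nat.ModEq, Nat.mod_eq_of_lt hN]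
    simp only [hcond, pow_val hzn]
    by_cases hdi : D ∣ i + b
    · rw [if_pos hdi]
      obtain ⟨w, hw'⟩ := hdi
      rw [hw', Nat.mul_div_cancel_left _ (by omega)]
      have h6 : ∀ t, D * q * t + i + b = D * (q * t + w) := by
        intro t
        rw [add_assoc, hw']; ring
      rw [← inner_sum he hqe (w := w) (z * ρ ^ w)]
      apply Finset.sum_congr rfl
      intro t _
      rw [h6]
      have h7 : D * e ∣ D * (q * t + w) ↔ e ∣ q * t + w := Nat.mul_dvd_mul_iff_left (by omega)
      by_cases h8 : e ∣ q * t + w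
      · rw [if_pos h8, if_pos (h7.2 h8)]
        obtain ⟨c, hc⟩ := h8
        rw [hc, ← mul_assoc, hpowω, ← hρe, ← pow_mul ρ e c, ← hc]
        congr 1
        apply pow_congr hρp
        obtain ⟨u, hu⟩ := hpq
        rw [hu, mul_assoc]
        simp [Nat.ModEq]
      · rw [if_neg h8, if_neg (fun hc => h8 (h7.1 hc))]
    · rw [if_neg hdi, mul_zero]
      symm
      apply Finset.sum_eq_zero
      intro t _
      rw [if_neg]
      intro hc
      apply hdi
      have h6 : D ∣ D * q * t + (i + b) := by
        rw [← add_assoc]; exact (dvd_mul_right D e).trans hc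
      rw [mul_assoc] at h6
      exact (Nat.dvd_add_right (dvd_mul_right D _)).1 h6
  exact (mul_eq_zero.1 h4).resolve_left hz0

lemma natDegree_gcd {p : ℕ} (hodd : Odd p) (e g n b : ℕ) [NeZero (p ^ n)] :
    (EuclideanDomain.gcd (Polynomial.X ^ (p ^ n) - 1) (Spoly p e g n b)).natDegree =
    ((Polynomial.nthRootsFinset (p ^ n) (1 : AlgebraicClosure (ZMod 2))).filter
      (fun z => SS p e g n b z = 0)).card := by
  set G := EuclideanDomain.gcd (Polynomial.X ^ (p ^ n) - 1) (Spoly p e g n b) with hG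
  have hsep : (Polynomial.X ^ (p ^ n) - 1 : Polynomial (ZMod 2)).Separable := by
    rw [Polynomial.X_pow_sub_one_separable_iff]
    have : Odd (p ^ n) := hodd.pow
    rw [Ne, ZMod.natCast_eq_zero_iff]
    exact fun h => (Nat.not_even_iff_odd.2 this) (even_iff_two_dvd.2 h)
  have hGsep : G.Separable := hsep.of_dvd (EuclideanDomain.gcd_dvd_left _ _)
  have hG0 : G ≠ 0 := hGsep.ne_zero
  rw [← Polynomial.card_rootSet_eq_natDegree (K := AlgebraicClosure (ZMod 2)) hGsep
    (IsAlgClosed.splits _)]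
  rw [← Set.toFinset_card]
  congr 1
  ext z
  have hP : 0 < p ^ n := Nat.pos_of_ne_zero (NeZero.ne _)
  rw [Set.mem_toFinset, Polynomial.mem_rootSet, Finset.mem_filter,
    Polynomial.mem_nthRootsFinset hP, ← eval_S]
  have := Polynomial.root_gcd_iff_root_left_right (ϕ := algebraMap (ZMod 2) (AlgebraicClosure (ZMod 2)))
    (f := (Polynomial.X ^ (p ^ n) - 1 : Polynomial (ZMod 2))) (g := Spoly p e g n b) (α := z)
  rw [← hG] at this
  rw [Polynomial.aeval_def, this, Polynomial.aeval_def]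
  simp [hG0, sub_eq_zero]

lemma half_card {Ω : Type*} [Field Ω] [CharP Ω 2] {p : ℕ} (hp : p.Prime) (hodd : Odd p) {g : ℕ}
    (hg : orderOf (g : ZMod (p ^ 2)) = Nat.totient (p ^ 2)) {e f : ℕ} (he : 0 < e)
    (hf0 : 0 < f)
    (hf : (p - 1) / e = f) (hef : f * e = p - 1) {h : ℕ} (hh : f = 2 * h)
    {n : ℕ} (hn : 1 ≤ n) [NeZero (p ^ n)]
    (b : ℕ) (h2 : (2 : ZMod (p ^ 1)) ∈ Dclass p e g 1 0)
    (R : Finset Ω) (hR : ∀ z, z ∈ R ↔ z ^ p = 1 ∧ z ≠ 1) (hcard : R.card = p - 1) :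
    (R.filter (fun z => SS p e g n b z = 0)).card = (p - 1) / 2 := by
  have hcop : Nat.Coprime (g ^ (p ^ (n - 1) * h)) p := (g_cop hp hodd hg).pow_left _
  set v := g ^ (p ^ (n - 1) * h) with hv
  have hsw : ∀ z ∈ R, SS p e g n b z + SS p e g n b (z ^ v) = 1 := by
    intro z hz
    rw [hR] at hz
    have hzn : z ^ (p ^ n) = 1 := by
      obtain ⟨k, rfl⟩ : ∃ k, n = k + 1 := ⟨n - 1, by omega⟩
      rw [pow_succ', pow_mul, hz.1, one_pow]
    exact SS_swap hp hodd hg he hf0 hf hef hh b hzn hz.2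
  obtain ⟨u, hu⟩ : ∃ u, v * u ≡ 1 [MOD p] := by
    refine ⟨v ^ (p - 2), ?_⟩
    have := Nat.ModEq.pow_totient hcop
    rw [Nat.totient_prime hp] at this
    have hpp := hp.two_le
    rw [← pow_succ']
    convert this using 2
    omega
  have hinv : ∀ z ∈ R, (z ^ v) ^ u = z := by
    intro z hz
    rw [← pow_mul, pow_congr ((hR z).1 hz).1 hu, pow_one]
  have hmap : ∀ z ∈ R, z ^ v ∈ R := by
    intro z hz
    have h3 := hinv z hz
    rw [hR] at hz ⊢
    refine ⟨by rw [← pow_mul, mul_comm, pow_mul, hz.1, one_pow], ?_⟩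
    intro hc
    rw [hc, one_pow] at h3
    exact hz.2 h3.symm
  have hinj : Set.InjOn (fun z : Ω => z ^ v) R := by
    intro x hx y hy hxy
    simp only at hxy
    rw [← hinv x hx, ← hinv y hy, hxy]
  have h01 : ∀ z ∈ R, SS p e g n b z = 0 ∨ SS p e g n b z = 1 := fun z hz =>
    SS_zero_or_one hp hodd hg he hf0 hf hef hn b ((hR z).1 hz).1 h2
  have hle1 : (R.filter (fun z => SS p e g n b z = 0)).card ≤
      (R.filter (fun z => ¬ SS p e g n b z = 0)).card := by
    refine Finset.card_le_card_of_injOn (fun z => z ^ v) ?_ (hinj.mono (by intro x hx; simp at hx; exact hx.1))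
    intro z hz
    simp only [Finset.coe_filter, Set.mem_setOf_eq] at hz ⊢
    refine ⟨hmap z hz.1, ?_⟩
    have := hsw z hz.1
    rw [hz.2, zero_add] at this
    rw [this]; exact one_ne_zero
  have hle2 : (R.filter (fun z => ¬ SS p e g n b z = 0)).card ≤
      (R.filter (fun z => SS p e g n b z = 0)).card := by
    refine Finset.card_le_card_of_injOn (fun z => z ^ v) ?_ (hinj.mono (by intro x hx; simp at hx; exact hx.1))
    intro z hz
    simp only [Finset.coe_filter, Set.mem_setOf_eq] at hz ⊢
    refine ⟨hmap z hz.1, ?_⟩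
    have := hsw z hz.1
    rw [(h01 z hz.1).resolve_left hz.2] at this
    simpa using this
  have := Finset.card_filter_add_card_filter_not (s := R) (fun z => SS p e g n b z = 0)
  omega

lemma main_card {p : ℕ} (hp : p.Prime) (hodd : Odd p)
    (hw : ¬ (2 ^ (p - 1) ≡ 1 [MOD p ^ 2])) {g : ℕ}
    (hg : orderOf (g : ZMod (p ^ 2)) = Nat.totient (p ^ 2)) {e f : ℕ} (he : 0 < e)
    (hf0 : 0 < f)
    (hf : (p - 1) / e = f) (hef : f * e = p - 1) {h : ℕ} (hh : f = 2 * h)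
    {n : ℕ} (hn : 1 ≤ n) [NeZero (p ^ n)] (b : ℕ) :
    ∃ R : Finset (AlgebraicClosure (ZMod 2)), (∀ z, z ∈ R ↔ z ^ p = 1 ∧ z ≠ 1) ∧ R.card = p - 1 ∧
    linComplexity p e g n b = p ^ n - (R.filter (fun z => SS p e g n b z = 0)).card
      - (if Even ((p ^ n + 1) / 2) then 1 else 0) := by
  have : CharP (AlgebraicClosure (ZMod 2)) 2 :=
    charP_of_injective_algebraMap (algebraMap (ZMod 2) (AlgebraicClosure (ZMod 2))).injective 2
  have hpΩ : NeZero (p : AlgebraicClosure (ZMod 2)) := ⟨by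
    rw [Ne, CharP.cast_eq_zero_iff (AlgebraicClosure (ZMod 2)) 2]
    exact fun h => (Nat.not_even_iff_odd.2 hodd) (even_iff_two_dvd.2 h)⟩
  have : NeZero p := ⟨hp.ne_zero⟩
  obtain ⟨ζ, hζ⟩ := HasEnoughRootsOfUnity.exists_primitiveRoot (AlgebraicClosure (ZMod 2)) p
  have hRm : ∀ z, z ∈ (Polynomial.nthRootsFinset p (1 : AlgebraicClosure (ZMod 2))).erase 1 ↔
      z ^ p = 1 ∧ z ≠ 1 := by
    intro z
    rw [Finset.mem_erase, Polynomial.mem_nthRootsFinset hp.pos, and_comm]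
  refine ⟨_, hRm, ?_, ?_⟩
  · rw [Finset.card_erase_of_mem, hζ.card_nthRootsFinset]
    rw [Polynomial.mem_nthRootsFinset hp.pos, one_pow]
  · set R := (Polynomial.nthRootsFinset p (1 : AlgebraicClosure (ZMod 2))).erase 1 with hR
    unfold linComplexity
    have h1 := natDegree_gcd hodd e g n b
    rw [Nat.sub_sub]
    congr 1
    refine Eq.trans (by convert rfl) (h1.trans ?_)
    have hS1 : SS p e g n b (1 : AlgebraicClosure (ZMod 2)) = 0 ↔ Even ((p ^ n + 1) / 2) := by
      unfold SS
      simp only [one_pow, Finset.sum_const, nsmul_eq_mul, mul_one]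
      rw [card_C1 hp hodd hg he hf0 hf hef hh, CharP.cast_eq_zero_iff (AlgebraicClosure (ZMod 2)) 2,
        even_iff_two_dvd]
    have hP : 0 < p ^ n := Nat.pos_of_ne_zero (NeZero.ne _)
    have h3 : (Polynomial.nthRootsFinset (p ^ n) (1 : AlgebraicClosure (ZMod 2))).filter
        (fun z => SS p e g n b z = 0) = R.filter (fun z => SS p e g n b z = 0) ∪
        (({1} : Finset (AlgebraicClosure (ZMod 2))).filter (fun z => SS p e g n b z = 0)) := by
      ext z
      rw [Finset.mem_union, Finset.mem_filter, Finset.mem_filter, Finset.mem_filter, hRm,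
        Polynomial.mem_nthRootsFinset hP, Finset.mem_singleton, ← or_and_right]
      refine and_congr_left fun hz0 => ?_
      constructor
      · intro hz
        by_cases hz1 : z = 1
        · exact Or.inr hz1
        left
        refine ⟨?_, hz1⟩
        by_contra hzp
        -- find the level
        have hex : ∃ k, z ^ (p ^ k) = 1 := ⟨n, hz⟩
        have hspec := Nat.find_spec hex
        have hmin := fun m (hm : m < Nat.find hex) => Nat.find_min hex hm
        have hle : Nat.find hex ≤ n := Nat.find_min' hex hz
        set m := Nat.find hex with hm
        have hm2 : 2 ≤ m := by
          by_contra hlt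
          have : m = 0 ∨ m = 1 := by omega
          rcases this with h | h
          · rw [h] at hspec; simp at hspec; exact hz1 hspec
          · rw [h] at hspec; simp at hspec; exact hzp hspec
        obtain ⟨k, hk⟩ : ∃ k, m = k + 1 := ⟨m - 1, by omega⟩
        rw [hk] at hspec
        exact SS_ne_zero_high hp hodd hw hg he hf0 hf hef hh b (by omega) (by omega) hspec
          (hmin k (by omega)) hz0
      · rintro (⟨hz, -⟩ | rfl)
        · obtain ⟨k, rfl⟩ : ∃ k, n = k + 1 := ⟨n - 1, by omega⟩
          rw [pow_succ', pow_mul, hz, one_pow]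
        · exact one_pow _
    rw [h3, Finset.card_union_of_disjoint]
    · congr 1
      rw [Finset.filter_singleton]
      by_cases hev : Even ((p ^ n + 1) / 2)
      · rw [if_pos hev, if_pos (hS1.2 hev), Finset.card_singleton]
      · rw [if_neg hev, if_neg (fun hc => hev (hS1.1 hc)), Finset.card_empty]
    · apply Finset.disjoint_filter_filter
      rw [Finset.disjoint_singleton_right, hRm]
      simp

end GCS

/-- let `p` be an odd prime with `2^(p-1) ≢ 1 (mod p²)`, `e ∣ p − 1` with
`f = (p−1)/e = 2^r`, `r ≥ 1`, `n ≥ 1`, `0 ≤ b ≤ p^(n-1)·f − 1`. Then the linear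
complexity `L` of the generalized cyclotomic binary sequence of period `p^n` satisfies
`L = p^n − (p−1)/2 − δ((p^n+1)/2)` if `2 mod p ∈ D_0^(p)` and
`L = p^n − δ((p^n+1)/2)` otherwise, where `δ(t) = 1` iff `t` is even. -/
theorem linear_complexity_generalized_cyclotomic_sequence
    (p : ℕ) (hp : p.Prime) (hodd : Odd p)
    (hw : ¬ (2 ^ (p - 1) ≡ 1 [MOD p ^ 2]))
    (e r : ℕ) (he : 0 < e) (hef : e ∣ p - 1) (hr : 1 ≤ r) (hf : (p - 1) / e = 2 ^ r)
    (g : ℕ) (hg : orderOf (g : ZMod (p ^ 2)) = Nat.totient (p ^ 2))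
    (n : ℕ) (hn : 1 ≤ n)
    (b : ℕ) (hb : b < p ^ (n - 1) * ((p - 1) / e)) :
    ((2 : ZMod (p ^ 1)) ∈ Dclass p e g 1 0 →
      linComplexity p e g n b
        = p ^ n - (p - 1) / 2 - (if Even ((p ^ n + 1) / 2) then 1 else 0)) ∧
    ((2 : ZMod (p ^ 1)) ∉ Dclass p e g 1 0 →
      linComplexity p e g n b
        = p ^ n - (if Even ((p ^ n + 1) / 2) then 1 else 0)) := by
  have : NeZero (p ^ n) := ⟨pow_ne_zero _ hp.ne_zero⟩
  have hf0 : 0 < 2 ^ r := by positivity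
  have hef' : 2 ^ r * e = p - 1 := by rw [← hf]; exact Nat.div_mul_cancel hef
  have hh : 2 ^ r = 2 * 2 ^ (r - 1) := by rw [← pow_succ']; congr 1; omega
  have : CharP (AlgebraicClosure (ZMod 2)) 2 :=
    charP_of_injective_algebraMap (algebraMap (ZMod 2) (AlgebraicClosure (ZMod 2))).injective 2
  obtain ⟨R, hR, hcard, hL⟩ := GCS.main_card hp hodd hw hg he hf0 hf hef' hh hn b
  constructor
  · intro h2
    rw [hL, GCS.half_card hp hodd hg he hf0 hf hef' hh hn b h2 R hR hcard]
  · intro h2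
    have h3 : R.filter (fun z => GCS.SS p e g n b z = 0) = ∅ := by
      rw [Finset.filter_eq_empty_iff]
      intro z hz
      rw [hR] at hz
      exact GCS.SS_ne_zero_p hp hodd hg he hr rfl hf hef' hn b hz.1 hz.2 h2
    rw [hL, h3, Finset.card_empty, Nat.sub_zero]
end
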